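/- arXiv:1601.04276 — 8 statements merged into one kernel-verified Lean document; each statement's English description precedes it below -/
import Mathlib

section
/- Fix finite nonempty sets 𝒳, 𝒵, a pmf P_X on 𝒳, and a channel W from 𝒳 to 𝒵. For a real rate R, define E_s^iid(P_X,W,R) := min over joint pmfs Q on 𝒳×𝒵 with Q ≪ P_X×W of { D(Q‖P_X×W) + max(R − f(Q‖P_X×W), 0) }, and for each positive integer n define E_{s,n}^iid(P_X,W,R) := min over n-types Q on 𝒳×𝒵 with Q ≪ P_X×W of the same expression. Then lim_{n→∞} E_{s,n}^iid(P_X,W,R) = E_s^iid(P_X,W,R). -/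
open Filter

noncomputable section

/-- A probability mass function on a finite alphabet. -/
def IsPMF {α : Type*} [Fintype α] (p : α → ℝ) : Prop :=
  (∀ a, 0 ≤ p a) ∧ ∑ a, p a = 1

/-- A channel from `𝒳` to `𝒵`: each input is mapped to a pmf on `𝒵`. -/
def IsChannel {𝒳 𝒵 : Type*} [Fintype 𝒵] (W : 𝒳 → 𝒵 → ℝ) : Prop :=
  ∀ x, IsPMF (W x)

/-- Absolute continuity: `Q a > 0` implies `Q' a > 0`. -/
def AbsCont {α : Type*} (Q Q' : α → ℝ) : Prop :=
  ∀ a, 0 < Q a → 0 < Q' a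

/-- Kullback–Leibler divergence `D(Q‖Q')` (the sum over the support of `Q`). -/
def klDiv {α : Type*} [Fintype α] (Q Q' : α → ℝ) : ℝ :=
  ∑ a, if 0 < Q a then Q a * Real.log (Q a / Q' a) else 0

/-- `x`-marginal of a joint distribution. -/
def margX {𝒳 𝒵 : Type*} [Fintype 𝒵] (Q : 𝒳 × 𝒵 → ℝ) : 𝒳 → ℝ :=
  fun x => ∑ z, Q (x, z)

/-- `z`-marginal of a joint distribution. -/
def margZ {𝒳 𝒵 : Type*} [Fintype 𝒳] (Q : 𝒳 × 𝒵 → ℝ) : 𝒵 → ℝ :=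
  fun z => ∑ x, Q (x, z)

/-- The joint pmf `(x,z) ↦ P(x) W(z|x)`. -/
def jointPW {𝒳 𝒵 : Type*} (P : 𝒳 → ℝ) (W : 𝒳 → 𝒵 → ℝ) : 𝒳 × 𝒵 → ℝ :=
  fun p => P p.1 * W p.1 p.2

/-- The function `f(Q‖Q') = Σ_{Q(x,z)>0} Q(x,z) ln( Q'(x,z) / (Q'_X(x) Q'_Z(z)) )`. -/
def fFun {𝒳 𝒵 : Type*} [Fintype 𝒳] [Fintype 𝒵] (Q Q' : 𝒳 × 𝒵 → ℝ) : ℝ :=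
  ∑ p, if 0 < Q p then Q p * Real.log (Q' p / (margX Q' p.1 * margZ Q' p.2)) else 0

/-- `Q` is an `n`-type: `n·Q(a)` is an integer for every `a`. -/
def IsType {α : Type*} (n : ℕ) (Q : α → ℝ) : Prop :=
  ∀ a, ∃ k : ℕ, Q a = (k : ℝ) / n

/-- `Q` rounded down to multiples of `1 / n`, with the missing mass put at the point `a₀`. -/
def roundType {α : Type*} [Fintype α] [DecidableEq α] (Q : α → ℝ) (a₀ : α) (n : ℕ) : α → ℝ :=
  fun a => (⌊Q a * n⌋₊ : ℝ) / n + if a = a₀ then 1 - ∑ b, (⌊Q b * n⌋₊ : ℝ) / n else 0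

theorem tendsto_roundType {α : Type*} [Fintype α] [DecidableEq α] {Q : α → ℝ} (hQ : IsPMF Q)
    (a₀ : α) : Tendsto (roundType Q a₀) atTop (nhds Q) := by
  have hfloor (a : α) : Tendsto (fun n : ℕ => (⌊Q a * n⌋₊ : ℝ) / n) atTop (nhds (Q a)) :=
    (tendsto_nat_floor_mul_div_atTop (hQ.1 a)).comp tendsto_natCast_atTop_atTop
  have hsum : Tendsto (fun n : ℕ => 1 - ∑ b, (⌊Q b * n⌋₊ : ℝ) / n) atTop (nhds 0) := by
    simpa [hQ.2] using (tendsto_finsetSum Finset.univ fun b _ => hfloor b).const_sub 1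
  refine tendsto_pi_nhds.2 fun a => ?_
  by_cases ha : a = a₀
  · simpa [roundType, ha] using (hfloor a₀).add hsum
  · simpa [roundType, ha] using hfloor a

theorem sum_floor_le {α : Type*} [Fintype α] {Q : α → ℝ} (hQ : IsPMF Q) (n : ℕ) :
    ∑ b, ⌊Q b * n⌋₊ ≤ n := by
  have h : ∑ b, (⌊Q b * n⌋₊ : ℝ) ≤ ∑ b, Q b * n :=
    Finset.sum_le_sum fun b _ => Nat.floor_le (mul_nonneg (hQ.1 b) n.cast_nonneg)
  rw [← Finset.sum_mul, hQ.2, one_mul] at h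
  exact_mod_cast h

theorem isType_roundType {α : Type*} [Fintype α] [DecidableEq α] {Q : α → ℝ} (hQ : IsPMF Q)
    (a₀ : α) {n : ℕ} (hn : 0 < n) : IsType n (roundType Q a₀ n) := by
  intro a
  refine ⟨⌊Q a * n⌋₊ + if a = a₀ then n - ∑ b, ⌊Q b * n⌋₊ else 0, ?_⟩
  have hn' : (n : ℝ) ≠ 0 := by positivity
  by_cases ha : a = a₀
  · simp only [roundType, ha, if_true, ← Finset.sum_div]
    push_cast [sum_floor_le hQ n]
    field_simp
  · simp [roundType, ha]

theorem isPMF_roundType {α : Type*} [Fintype α] [DecidableEq α] {Q : α → ℝ} (hQ : IsPMF Q)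
    (a₀ : α) {n : ℕ} (hn : 0 < n) : IsPMF (roundType Q a₀ n) := by
  refine ⟨fun a => ?_, ?_⟩
  · obtain ⟨k, hk⟩ := isType_roundType hQ a₀ hn a
    rw [hk]
    positivity
  · simp [roundType, Finset.sum_add_distrib]

theorem absCont_roundType {α : Type*} [Fintype α] [DecidableEq α] {Q : α → ℝ} (hQ : IsPMF Q)
    {a₀ : α} (ha₀ : 0 < Q a₀) (n : ℕ) : AbsCont (roundType Q a₀ n) Q := by
  intro a ha
  by_contra h
  have hQa : Q a = 0 := le_antisymm (not_lt.1 h) (hQ.1 a)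
  have hne : a ≠ a₀ := by
    rintro rfl
    exact h ha₀
  simp [roundType, hne, hQa] at ha

theorem IsPMF.exists_pos {α : Type*} [Fintype α] {Q : α → ℝ} (hQ : IsPMF Q) : ∃ a, 0 < Q a := by
  by_contra! h
  have := hQ.2 ▸ Finset.sum_nonpos fun a (_ : a ∈ Finset.univ) => h a
  norm_num at this

theorem isCompact_setOf_isPMF_absCont {α : Type*} [Fintype α] (Q' : α → ℝ) :
    IsCompact {Q : α → ℝ | IsPMF Q ∧ AbsCont Q Q'} := by
  have hclosed : IsClosed {Q : α → ℝ | AbsCont Q Q'} := by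
    simp only [AbsCont, Set.ofPred_forall]
    refine isClosed_iInter fun a => ?_
    by_cases ha : 0 < Q' a
    · simp [ha]
    · simpa [ha] using isClosed_le (continuous_apply a) continuous_const
  exact (isCompact_stdSimplex ℝ α).inter_right hclosed

/-- The minimum of a continuous function over the `n`-types dominated by `Q'` converges to its
minimum over all pmfs dominated by `Q'`. -/
theorem tendsto_sInf_types {α : Type*} [Fintype α] {Q' : α → ℝ} (hQ' : IsPMF Q')
    {G H : (α → ℝ) → ℝ} (hH : Continuous H)
    (hGH : ∀ Q, IsPMF Q → AbsCont Q Q' → G Q = H Q) :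
    Tendsto (fun n : ℕ => sInf {e : ℝ | ∃ Q, IsPMF Q ∧ IsType n Q ∧ AbsCont Q Q' ∧ e = G Q})
      atTop (nhds (sInf {e : ℝ | ∃ Q, IsPMF Q ∧ AbsCont Q Q' ∧ e = G Q})) := by
  classical
  obtain ⟨Q, ⟨hQ, hac⟩, hmin⟩ := (isCompact_setOf_isPMF_absCont Q').exists_isMinOn
    ⟨Q', hQ', fun _ h => h⟩ hH.continuousOn
  have hle (q : α → ℝ) (hq : IsPMF q) (hqc : AbsCont q Q') : H Q ≤ G q :=
    hGH q hq hqc ▸ hmin ⟨hq, hqc⟩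
  have hinf : sInf {e : ℝ | ∃ Q, IsPMF Q ∧ AbsCont Q Q' ∧ e = G Q} = H Q := by
    refine IsLeast.csInf_eq ⟨⟨Q, hQ, hac, (hGH Q hQ hac).symm⟩, ?_⟩
    rintro _ ⟨q, hq, hqc, rfl⟩
    exact hle q hq hqc
  obtain ⟨a₀, ha₀⟩ := hQ.exists_pos
  have hround (n : ℕ) : AbsCont (roundType Q a₀ n) Q' :=
    fun a ha => hac a (absCont_roundType hQ ha₀ n a ha)
  have hmem (n : ℕ) (hn : 0 < n) : H (roundType Q a₀ n) ∈
      {e : ℝ | ∃ Q, IsPMF Q ∧ IsType n Q ∧ AbsCont Q Q' ∧ e = G Q} :=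
    ⟨_, isPMF_roundType hQ a₀ hn, isType_roundType hQ a₀ hn, hround n,
      (hGH _ (isPMF_roundType hQ a₀ hn) (hround n)).symm⟩
  rw [hinf]
  refine tendsto_of_tendsto_of_tendsto_of_le_of_le' tendsto_const_nhds
    ((hH.tendsto Q).comp (tendsto_roundType hQ a₀)) ?_ ?_
  · filter_upwards [eventually_gt_atTop 0] with n hn
    refine le_csInf ⟨_, hmem n hn⟩ ?_
    rintro _ ⟨q, hq, -, hqc, rfl⟩
    exact hle q hq hqc
  · filter_upwards [eventually_gt_atTop 0] with n hn
    refine csInf_le ⟨H Q, ?_⟩ (hmem n hn)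
    rintro _ ⟨q, hq, -, hqc, rfl⟩
    exact hle q hq hqc

theorem klDiv_eq_sum {α : Type*} [Fintype α] {Q Q' : α → ℝ} (hQ : IsPMF Q) (hac : AbsCont Q Q') :
    klDiv Q Q' = ∑ a, (Q a * Real.log (Q a) - Q a * Real.log (Q' a)) := by
  refine Finset.sum_congr rfl fun a _ => ?_
  rcases (hQ.1 a).eq_or_lt with h | h
  · simp [← h]
  · rw [if_pos h, Real.log_div h.ne' (hac a h).ne', mul_sub]

theorem fFun_eq_sum {𝒳 𝒵 : Type*} [Fintype 𝒳] [Fintype 𝒵] {Q : 𝒳 × 𝒵 → ℝ} (hQ : IsPMF Q)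
    (Q' : 𝒳 × 𝒵 → ℝ) :
    fFun Q Q' = ∑ p, Q p * Real.log (Q' p / (margX Q' p.1 * margZ Q' p.2)) := by
  refine Finset.sum_congr rfl fun p _ => ?_
  rcases (hQ.1 p).eq_or_lt with h | h
  · simp [← h]
  · rw [if_pos h]

theorem isPMF_jointPW {𝒳 𝒵 : Type*} [Fintype 𝒳] [Fintype 𝒵] {P : 𝒳 → ℝ} {W : 𝒳 → 𝒵 → ℝ}
    (hP : IsPMF P) (hW : IsChannel W) : IsPMF (jointPW P W) := by
  refine ⟨fun p => mul_nonneg (hP.1 p.1) ((hW p.1).1 p.2), ?_⟩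
  simp [jointPW, Fintype.sum_prod_type, ← Finset.mul_sum, (hW _).2, hP.2]

theorem exact_iid_exponent_limit
    {𝒳 𝒵 : Type*} [Fintype 𝒳] [Fintype 𝒵] [Nonempty 𝒳] [Nonempty 𝒵]
    (P_X : 𝒳 → ℝ) (W : 𝒳 → 𝒵 → ℝ) (hP : IsPMF P_X) (hW : IsChannel W) (R : ℝ) :
    Tendsto
      (fun n : ℕ =>
        sInf { e : ℝ | ∃ Q : 𝒳 × 𝒵 → ℝ, IsPMF Q ∧ IsType n Q ∧
          AbsCont Q (jointPW P_X W) ∧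
          e = klDiv Q (jointPW P_X W) + max (R - fFun Q (jointPW P_X W)) 0 })
      atTop
      (nhds (sInf { e : ℝ | ∃ Q : 𝒳 × 𝒵 → ℝ, IsPMF Q ∧
          AbsCont Q (jointPW P_X W) ∧
          e = klDiv Q (jointPW P_X W) + max (R - fFun Q (jointPW P_X W)) 0 })) := by
  refine tendsto_sInf_types (isPMF_jointPW hP hW)
    (G := fun Q => klDiv Q (jointPW P_X W) + max (R - fFun Q (jointPW P_X W)) 0)
    (H := fun Q => ∑ a, (Q a * Real.log (Q a) - Q a * Real.log (jointPW P_X W a)) +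
      max (R - ∑ p, Q p * Real.log (jointPW P_X W p /
        (margX (jointPW P_X W) p.1 * margZ (jointPW P_X W) p.2))) 0) ?_ ?_
  · have hlog (a : 𝒳 × 𝒵) : Continuous fun Q : 𝒳 × 𝒵 → ℝ => Q a * Real.log (Q a) :=
      Real.continuous_mul_log.comp (continuous_apply a)
    fun_prop
  · intro Q hQ hac
    simp only [klDiv_eq_sum hQ hac, fFun_eq_sum hQ]

end
end

section
/- Fix finite nonempty sets 𝒳, 𝒵, a channel W from 𝒳 to 𝒵, a pmf P_X on 𝒳 with P_X(x)>0 for all x ∈ 𝒳, a real rate R, and a sequence (P_n) where P_n is an n-type on 𝒳 with full support such that |P_n − P_X| → 0. For each n define g_n(V‖W|P_n) := ω(V‖W|P_n) + H(P_n∘V) + min{ D(V'‖W|P_n) : V' a channel with P_n×V' an n-type and P_n∘V' = P_n∘V }, and E_{s,n}^cc(P_n,W,R) := min over channels V with P_n×V an n-type of { D(V‖W|P_n) + max(R − g_n(V‖W|P_n), 0) }. Define g(V‖W|P_X) := ω(V‖W|P_X) + H(P_X∘V) + min{ D(V'‖W|P_X) : V' a channel with P_X∘V' = P_X∘V }, and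 E_s^cc(P_X,W,R) := min over channels V of { D(V‖W|P_X) + max(R − g(V‖W|P_X), 0) }. Then lim_{n→∞} E_{s,n}^cc(P_n,W,R) = E_s^cc(P_X,W,R). -/
open Filter

noncomputable section

/-- The output distribution `(P∘V)(z) = Σ_x P(x)V(z|x)`. -/
def outDist {𝒳 𝒵 : Type*} [Fintype 𝒳] (P : 𝒳 → ℝ) (V : 𝒳 → 𝒵 → ℝ) : 𝒵 → ℝ :=
  fun z => ∑ x, P x * V x z

/-- Shannon entropy `H(Q)`. -/
def entropy {α : Type*} [Fintype α] (Q : α → ℝ) : ℝ :=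
  -∑ a, if 0 < Q a then Q a * Real.log (Q a) else 0

/-- Conditional KL divergence `D(V‖W|P) = Σ_x P(x) D(V(·|x)‖W(·|x))`, with value `+∞`
whenever some `x, z` with `P(x) > 0` have `V(z|x) > 0 = W(z|x)`. -/
def condKL {𝒳 𝒵 : Type*} [Fintype 𝒳] [Fintype 𝒵]
    (V W : 𝒳 → 𝒵 → ℝ) (P : 𝒳 → ℝ) : EReal :=
  if ∀ x z, 0 < P x → 0 < V x z → 0 < W x z then
    ((∑ x, P x * klDiv (V x) (W x) : ℝ) : EReal)
  else ⊤

/-- `ω(V‖W|P) = Σ_{(x,z): P(x)V(z|x)>0} P(x)V(z|x) ln W(z|x)`, with value `−∞`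
whenever some such `W(z|x)` vanishes. -/
def omegaF {𝒳 𝒵 : Type*} [Fintype 𝒳] [Fintype 𝒵]
    (V W : 𝒳 → 𝒵 → ℝ) (P : 𝒳 → ℝ) : EReal :=
  if ∀ x z, 0 < P x * V x z → 0 < W x z then
    ((∑ p : 𝒳 × 𝒵, if 0 < P p.1 * V p.1 p.2 then
        P p.1 * V p.1 p.2 * Real.log (W p.1 p.2) else 0 : ℝ) : EReal)
  else ⊥

/-- `g(V‖W|P) = ω(V‖W|P) + H(P∘V) + min{ D(V'‖W|P) : V' a channel with P∘V' = P∘V }`. -/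
def gFun {𝒳 𝒵 : Type*} [Fintype 𝒳] [Fintype 𝒵]
    (V W : 𝒳 → 𝒵 → ℝ) (P : 𝒳 → ℝ) : EReal :=
  omegaF V W P + ((entropy (outDist P V) : ℝ) : EReal) +
    sInf { d : EReal | ∃ V' : 𝒳 → 𝒵 → ℝ, IsChannel V' ∧
      (∀ z, outDist P V' z = outDist P V z) ∧ d = condKL V' W P }

/-- The exact constant-composition secrecy/resolvability exponent
`E_s^cc(P,W,R) = min over channels V of { D(V‖W|P) + [R − g(V‖W|P)]⁺ }`. -/
def EsCC {𝒳 𝒵 : Type*} [Fintype 𝒳] [Fintype 𝒵]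
    (P : 𝒳 → ℝ) (W : 𝒳 → 𝒵 → ℝ) (R : ℝ) : EReal :=
  sInf { e : EReal | ∃ V : 𝒳 → 𝒵 → ℝ, IsChannel V ∧
    e = condKL V W P + max ((R : EReal) - gFun V W P) 0 }

/-- Finite-blocklength version of `g`:
`g_n(V‖W|P) = ω(V‖W|P) + H(P∘V) +
  min{ D(V'‖W|P) : V' a channel, P×V' an n-type, P∘V' = P∘V }`. -/
def gFunN {𝒳 𝒵 : Type*} [Fintype 𝒳] [Fintype 𝒵] (n : ℕ)
    (V W : 𝒳 → 𝒵 → ℝ) (P : 𝒳 → ℝ) : EReal :=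
  omegaF V W P + ((entropy (outDist P V) : ℝ) : EReal) +
    sInf { d : EReal | ∃ V' : 𝒳 → 𝒵 → ℝ, IsChannel V' ∧ IsType n (jointPW P V') ∧
      (∀ z, outDist P V' z = outDist P V z) ∧ d = condKL V' W P }

/-- Finite-blocklength constant-composition exponent:
`E_{s,n}^cc(P,W,R) = min over channels V with P×V an n-type of
  { D(V‖W|P) + [R − g_n(V‖W|P)]⁺ }`. -/
def EsCCn {𝒳 𝒵 : Type*} [Fintype 𝒳] [Fintype 𝒵] (n : ℕ)
    (P : 𝒳 → ℝ) (W : 𝒳 → 𝒵 → ℝ) (R : ℝ) : EReal :=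
  sInf { e : EReal | ∃ V : 𝒳 → 𝒵 → ℝ, IsChannel V ∧ IsType n (jointPW P V) ∧
    e = condKL V W P + max ((R : EReal) - gFunN n V W P) 0 }

open Topology

/-- Integer vectors `N n` with `N n / n → Δ` that satisfy every homogeneous integer linear
relation satisfied by `Δ`. -/
lemma exists_int_approx {ι : Type*} [Fintype ι] (Δ : ι → ℝ) :
    ∃ N : ℕ → ι → ℤ,
      (∀ i, Tendsto (fun n => (N n i : ℝ) / n) atTop (𝓝 (Δ i))) ∧
      ∀ s : ι → ℤ, ∑ i, (s i : ℝ) * Δ i = 0 → ∀ n, ∑ i, s i * N n i = 0 := by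
  classical
  let M : Submodule ℤ ℝ := Submodule.span ℤ (Set.range Δ)
  have : Module.Finite ℤ M := Module.Finite.span_of_finite ℤ (Set.finite_range Δ)
  let b := Module.Free.chooseBasis ℤ M
  let d : ι → M := fun i => ⟨Δ i, Submodule.subset_span ⟨i, rfl⟩⟩
  have hd : ∀ i, Δ i = ∑ j, (b.repr (d i) j : ℝ) * (b j : ℝ) := by
    intro i
    have h := congrArg (Subtype.val) (b.sum_repr (d i))
    have h' : (∑ j, ((b.repr (d i) j • b j : M) : ℝ)) = Δ i :=
      (Submodule.coe_sum M _ _).symm.trans h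
    rw [← h']
    exact Finset.sum_congr rfl fun j _ => by simp
  refine ⟨fun n i => ∑ j, b.repr (d i) j * ⌊(b j : ℝ) * n⌋, ?_, ?_⟩
  · intro i
    rw [hd i]
    have hfl : ∀ a : ℝ, Tendsto (fun n : ℕ => (⌊a * n⌋ : ℝ) / n) atTop (𝓝 a) := by
      intro a
      have h1 : Tendsto (fun n : ℕ => a - 1 / (n : ℝ)) atTop (𝓝 a) := by
        simpa using tendsto_const_nhds.sub (tendsto_one_div_atTop_nhds_zero_nat (𝕜 := ℝ))
      refine tendsto_of_tendsto_of_tendsto_of_le_of_le' h1 tendsto_const_nhds ?_ ?_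
      · filter_upwards [eventually_gt_atTop 0] with n hn
        have hn' : (0 : ℝ) < n := by exact_mod_cast hn
        rw [le_div_iff₀ hn', sub_mul, div_mul_cancel₀ _ hn'.ne']
        exact (Int.sub_one_lt_floor _).le
      · filter_upwards [eventually_gt_atTop 0] with n hn
        have hn' : (0 : ℝ) < n := by exact_mod_cast hn
        rw [div_le_iff₀ hn']
        exact Int.floor_le _
    have := tendsto_finsetSum Finset.univ
      (fun j _ => (hfl (b j : ℝ)).const_mul (b.repr (d i) j : ℝ))
    refine this.congr fun n => ?_
    push_cast
    rw [Finset.sum_div]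
    exact Finset.sum_congr rfl fun j _ => by ring
  · intro s hs n
    have h0 : ∑ i, s i • d i = 0 := by
      apply Subtype.ext
      simpa [d] using hs
    have h1 : ∀ j, ∑ i, s i * b.repr (d i) j = 0 := by
      intro j
      have := congrArg (fun v => b.repr v j) h0
      simpa [map_sum] using this
    simp_rw [Finset.mul_sum]
    rw [Finset.sum_comm]
    refine Finset.sum_eq_zero fun j _ => ?_
    simp_rw [← mul_assoc]
    rw [← Finset.sum_mul, h1, zero_mul]

lemma IsCompact.eventually_forall_of_prod {X ι : Type*} [TopologicalSpace X] {K : Set X}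
    (hK : IsCompact K) {f : Filter ι} {p : ι → X → Prop}
    (h : ∀ x ∈ K, ∀ᶠ q in f ×ˢ 𝓝[K] x, p q.1 q.2) :
    ∀ᶠ i in f, ∀ x ∈ K, p i x := by
  suffices H : ∀ᶠ i in f, ∀ x ∈ K, x ∈ K → p i x from
    H.mono fun i hi x hx => hi x hx hx
  refine hK.induction_on (p := fun s => ∀ᶠ i in f, ∀ x ∈ s, x ∈ K → p i x) (by simp)
    (fun s t hst ht => ht.mono fun i hi x hx => hi x (hst hx))
    (fun s t hs ht => ?_) (fun x hx => ?_)
  · filter_upwards [hs, ht] with i h1 h2 x hx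
    exact hx.elim (h1 x) (h2 x)
  · obtain ⟨pa, hpa, pb, hpb, hab⟩ := eventually_prod_iff.1 (h x hx)
    exact ⟨{y | pb y}, hpb, hpa.mono fun i hi y hy _ => hab hi hy⟩

/-- Channels dominated by `W`. -/
def domChannels {𝒳 𝒵 : Type*} [Fintype 𝒵] (W : 𝒳 → 𝒵 → ℝ) : Set (𝒳 → 𝒵 → ℝ) :=
  {V | IsChannel V ∧ ∀ x z, 0 < V x z → 0 < W x z}

lemma isCompact_domChannels {𝒳 𝒵 : Type*} [Fintype 𝒵] (W : 𝒳 → 𝒵 → ℝ)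
    (hW : IsChannel W) :
    IsCompact (domChannels W) := by
  have hsub : domChannels W ⊆
      Set.pi Set.univ fun _ => Set.pi Set.univ fun _ => Set.Icc (0 : ℝ) 1 := by
    rintro V ⟨hV, -⟩ x - z -
    refine ⟨(hV x).1 z, ?_⟩
    rw [← (hV x).2]
    exact Finset.single_le_sum (fun z _ => (hV x).1 z) (Finset.mem_univ z)
  refine IsCompact.of_isClosed_subset
    (isCompact_univ_pi fun _ => isCompact_univ_pi fun _ => isCompact_Icc) ?_ hsub
  have : domChannels W = ⋂ x, (({V | ∑ z, V x z = 1} : Set (𝒳 → 𝒵 → ℝ)) ∩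
      ⋂ z, ({V | 0 ≤ V x z} ∩ {V | W x z = 0 → V x z ≤ 0})) := by
    ext V
    simp only [domChannels, IsChannel, IsPMF, Set.mem_ofPred_eq, Set.mem_iInter, Set.mem_inter_iff]
    constructor
    · rintro ⟨h1, h2⟩ x
      refine ⟨(h1 x).2, fun z => ⟨(h1 x).1 z, fun h0 => ?_⟩⟩
      by_contra! hc
      exact (h2 x z hc).ne' h0
    · intro h
      refine ⟨fun x => ⟨fun z => ((h x).2 z).1, (h x).1⟩, fun x z hv => ?_⟩
      refine lt_of_le_of_ne ((hW x).1 z) fun h0 => ?_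
      exact absurd (((h x).2 z).2 h0.symm) (not_le.2 hv)
  rw [this]
  refine isClosed_iInter fun x => IsClosed.inter (isClosed_eq (by fun_prop) (by fun_prop))
    (isClosed_iInter fun z => IsClosed.inter (isClosed_le (by fun_prop) (by fun_prop)) ?_)
  by_cases h0 : W x z = 0
  · simpa [h0] using isClosed_le (by fun_prop : Continuous fun V : 𝒳 → 𝒵 → ℝ => V x z)
      continuous_const
  · simp [h0]

lemma continuous_outDist {𝒳 𝒵 : Type*} [Fintype 𝒳] (z : 𝒵) :
    Continuous fun q : (𝒳 → ℝ) × (𝒳 → 𝒵 → ℝ) => outDist q.1 q.2 z := by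
  unfold outDist
  fun_prop

section Exponent

variable {𝒳 𝒵 : Type*} [Fintype 𝒳] [Fintype 𝒵]

/-- Real-valued conditional divergence, in a form continuous in `(P, V)`. -/
def condKLReal (W : 𝒳 → 𝒵 → ℝ) (P : 𝒳 → ℝ) (V : 𝒳 → 𝒵 → ℝ) : ℝ :=
  ∑ x, P x * ∑ z, (V x z * Real.log (V x z) - V x z * Real.log (W x z))

/-- Real-valued form of `ω(V‖W|P) + H(P∘V)`. -/
def omegaEntropy (W : 𝒳 → 𝒵 → ℝ) (P : 𝒳 → ℝ) (V : 𝒳 → 𝒵 → ℝ) : ℝ :=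
  (∑ p : 𝒳 × 𝒵, P p.1 * V p.1 p.2 * Real.log (W p.1 p.2)) +
    ∑ z, Real.negMulLog (outDist P V z)

lemma continuous_condKLReal (W : 𝒳 → 𝒵 → ℝ) :
    Continuous fun q : (𝒳 → ℝ) × (𝒳 → 𝒵 → ℝ) => condKLReal W q.1 q.2 := by
  unfold condKLReal
  refine continuous_finsetSum _ fun x _ => Continuous.mul (by fun_prop) ?_
  refine continuous_finsetSum _ fun z _ => Continuous.sub ?_ (by fun_prop)
  exact Real.continuous_mul_log.comp (by fun_prop :
    Continuous fun q : (𝒳 → ℝ) × (𝒳 → 𝒵 → ℝ) => q.2 x z)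

lemma continuous_omegaEntropy (W : 𝒳 → 𝒵 → ℝ) :
    Continuous fun q : (𝒳 → ℝ) × (𝒳 → 𝒵 → ℝ) => omegaEntropy W q.1 q.2 := by
  unfold omegaEntropy
  refine Continuous.add (by fun_prop) (continuous_finsetSum _ fun z _ => ?_)
  exact Real.continuous_negMulLog.comp (continuous_outDist z)

variable {W V : 𝒳 → 𝒵 → ℝ} {P : 𝒳 → ℝ}

lemma outDist_nonneg (hP : ∀ x, 0 < P x) (hV : IsChannel V) (z : 𝒵) : 0 ≤ outDist P V z :=
  Finset.sum_nonneg fun x _ => mul_nonneg (hP x).le ((hV x).1 z)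

lemma condKL_eq (hV : V ∈ domChannels W) : condKL V W P = (condKLReal W P V : EReal) := by
  unfold condKL
  rw [if_pos fun x z _ => hV.2 x z]
  congr 1
  refine Finset.sum_congr rfl fun x _ => ?_
  congr 1
  refine Finset.sum_congr rfl fun z _ => ?_
  split_ifs with h
  · rw [Real.log_div h.ne' (hV.2 x z h).ne']
    ring
  · simp [le_antisymm (not_lt.1 h) ((hV.1 x).1 z)]

lemma condKL_eq_top (hP : ∀ x, 0 < P x) (hV : IsChannel V) (h : V ∉ domChannels W) :
    condKL V W P = ⊤ := by
  unfold condKL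
  rw [if_neg]
  exact fun h' => h ⟨hV, fun x z => h' x z (hP x)⟩

lemma omegaF_add_entropy (hP : ∀ x, 0 < P x) (hV : V ∈ domChannels W) :
    omegaF V W P + ((entropy (outDist P V) : ℝ) : EReal) = (omegaEntropy W P V : EReal) := by
  unfold omegaF
  rw [if_pos fun x z h => hV.2 x z (pos_of_mul_pos_right h (hP x).le), ← EReal.coe_add]
  unfold omegaEntropy entropy
  congr 2
  · refine Finset.sum_congr rfl fun p _ => ?_
    split_ifs with h
    · rfl
    · have h0 : P p.1 * V p.1 p.2 = 0 :=
        le_antisymm (not_lt.1 h) (mul_nonneg (hP _).le ((hV.1 _).1 _))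
      rw [h0, zero_mul]
  · rw [← Finset.sum_neg_distrib]
    refine Finset.sum_congr rfl fun z _ => ?_
    split_ifs with h
    · simp [Real.negMulLog]
    · simp [le_antisymm (not_lt.1 h) (outDist_nonneg hP hV.1 z)]

lemma gFun_le (hP : ∀ x, 0 < P x) (hV : V ∈ domChannels W) {V' : 𝒳 → 𝒵 → ℝ}
    (hV' : V' ∈ domChannels W) (ho : ∀ z, outDist P V' z = outDist P V z) :
    gFun V W P ≤ ((omegaEntropy W P V + condKLReal W P V' : ℝ) : EReal) := by
  unfold gFun
  rw [omegaF_add_entropy hP hV, EReal.coe_add]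
  exact add_le_add le_rfl (sInf_le ⟨V', hV'.1, ho, (condKL_eq hV').symm⟩)

lemma gFunN_le {n : ℕ} (hP : ∀ x, 0 < P x) (hV : V ∈ domChannels W) {V' : 𝒳 → 𝒵 → ℝ}
    (hV' : V' ∈ domChannels W) (ht : IsType n (jointPW P V'))
    (ho : ∀ z, outDist P V' z = outDist P V z) :
    gFunN n V W P ≤ ((omegaEntropy W P V + condKLReal W P V' : ℝ) : EReal) := by
  unfold gFunN
  rw [omegaF_add_entropy hP hV, EReal.coe_add]
  exact add_le_add le_rfl (sInf_le ⟨V', hV'.1, ht, ho, (condKL_eq hV').symm⟩)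

lemma le_gFun (hP : ∀ x, 0 < P x) (hV : V ∈ domChannels W) {c : ℝ}
    (h : ∀ V' ∈ domChannels W, (∀ z, outDist P V' z = outDist P V z) → c ≤ condKLReal W P V') :
    ((omegaEntropy W P V + c : ℝ) : EReal) ≤ gFun V W P := by
  unfold gFun
  rw [omegaF_add_entropy hP hV, EReal.coe_add]
  refine add_le_add le_rfl (le_sInf ?_)
  rintro _ ⟨V', hc, ho, rfl⟩
  by_cases hV' : V' ∈ domChannels W
  · rw [condKL_eq hV']
    exact_mod_cast h V' hV' ho
  · rw [condKL_eq_top hP hc hV']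
    exact le_top

lemma gFun_le_gFunN (n : ℕ) (hP : ∀ x, 0 < P x) (hV : V ∈ domChannels W) :
    gFun V W P ≤ gFunN n V W P := by
  unfold gFun gFunN
  rw [omegaF_add_entropy hP hV]
  refine add_le_add le_rfl (sInf_le_sInf ?_)
  rintro _ ⟨V', hc, -, ho, rfl⟩
  exact ⟨V', hc, ho, rfl⟩

lemma EsCC_le {R : ℝ} (hV : IsChannel V) :
    EsCC P W R ≤ condKL V W P + max ((R : EReal) - gFun V W P) 0 :=
  sInf_le ⟨V, hV, rfl⟩

lemma EsCCn_le {n : ℕ} {R : ℝ} (hV : IsChannel V) (ht : IsType n (jointPW P V)) :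
    EsCCn n P W R ≤ condKL V W P + max ((R : EReal) - gFunN n V W P) 0 :=
  sInf_le ⟨V, hV, ht, rfl⟩

lemma add_max_le_coe {R d j : ℝ} {g : EReal} (h : (j : EReal) ≤ g) :
    (d : EReal) + max ((R : EReal) - g) 0 ≤ ((d + max (R - j) 0 : ℝ) : EReal) := by
  rw [EReal.coe_add]
  refine add_le_add le_rfl (max_le ?_ ?_)
  · refine (EReal.sub_le_sub le_rfl h).trans ?_
    rw [← EReal.coe_sub]
    exact_mod_cast le_max_left _ _
  · exact_mod_cast le_max_right _ _

lemma coe_le_add_max {R d j : ℝ} {g : EReal} (h : g ≤ (j : EReal)) :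
    ((d + (R - j) : ℝ) : EReal) ≤ (d : EReal) + max ((R : EReal) - g) 0 := by
  rw [EReal.coe_add]
  refine add_le_add le_rfl (le_max_of_le_left ?_)
  rw [EReal.coe_sub]
  exact EReal.sub_le_sub le_rfl h

lemma coe_le_add_max_zero (R d : ℝ) (g : EReal) :
    (d : EReal) ≤ (d : EReal) + max ((R : EReal) - g) 0 :=
  le_add_of_nonneg_right (le_max_right _ _)

lemma top_add_max_zero (y : EReal) : (⊤ : EReal) + max y 0 = ⊤ :=
  EReal.top_add_of_ne_bot (((EReal.bot_lt_zero).trans_le (le_max_right y 0)).ne')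

/-- Every channel dominated by `W` is a limit of dominated channels whose joint law with the
given types `Pn n` is an `n`-type. -/
lemma exists_type_channels {P_X : 𝒳 → ℝ} (hPpos : ∀ x, 0 < P_X x) {Pn : ℕ → 𝒳 → ℝ}
    (hPn : ∀ᶠ n in atTop, IsPMF (Pn n) ∧ IsType n (Pn n) ∧ ∀ x, 0 < Pn n x)
    (hconv : Tendsto Pn atTop (𝓝 P_X)) (hV : V ∈ domChannels W) :
    ∃ Vn : ℕ → 𝒳 → 𝒵 → ℝ, Tendsto Vn atTop (𝓝 V) ∧
      ∀ᶠ n in atTop, Vn n ∈ domChannels W ∧ IsType n (jointPW (Pn n) (Vn n)) := by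
  classical
  have hz : ∀ x, ∃ z, 0 < V x z := by
    intro x
    by_contra! h
    have h1 := Finset.sum_nonpos fun z (_ : z ∈ Finset.univ) => h z
    rw [(hV.1 x).2] at h1
    linarith
  choose z₀ hz₀ using hz
  let fl : ℕ → 𝒳 → 𝒵 → ℕ := fun n x z => ⌊V x z * (n * Pn n x)⌋₊
  let Vn : ℕ → 𝒳 → 𝒵 → ℝ := fun n x z =>
    if z = z₀ x then 1 - ∑ z' ∈ Finset.univ.erase (z₀ x), (fl n x z' : ℝ) / (n * Pn n x)
    else (fl n x z : ℝ) / (n * Pn n x)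
  have hy : ∀ x, Tendsto (fun n : ℕ => (n : ℝ) * Pn n x) atTop atTop := fun x =>
    tendsto_natCast_atTop_atTop.atTop_mul_pos (hPpos x) (tendsto_pi_nhds.1 hconv x)
  have hlim : ∀ x z, Tendsto (fun n => (fl n x z : ℝ) / (n * Pn n x)) atTop (𝓝 (V x z)) :=
    fun x z => (tendsto_nat_floor_mul_div_atTop ((hV.1 x).1 z)).comp (hy x)
  have hsplit : ∀ x, V x (z₀ x) = 1 - ∑ z' ∈ Finset.univ.erase (z₀ x), V x z' := by
    intro x
    rw [← (hV.1 x).2, ← Finset.add_sum_erase _ _ (Finset.mem_univ (z₀ x))]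
    ring
  refine ⟨Vn, ?_, ?_⟩
  · refine tendsto_pi_nhds.2 fun x => tendsto_pi_nhds.2 fun z => ?_
    by_cases h : z = z₀ x
    · simp only [Vn, h, if_true]
      rw [hsplit x]
      exact tendsto_const_nhds.sub (tendsto_finsetSum _ fun z' _ => hlim x z')
    · simpa only [Vn, h, if_false] using hlim x z
  · filter_upwards [hPn, eventually_gt_atTop 0] with n ⟨_, htype, hpos⟩ hn
    have hn' : (0 : ℝ) < n := by exact_mod_cast hn
    have hy' : ∀ x, 0 < (n : ℝ) * Pn n x := fun x => mul_pos hn' (hpos x)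
    have hfle : ∀ x z, (fl n x z : ℝ) / (n * Pn n x) ≤ V x z := by
      intro x z
      rw [div_le_iff₀ (hy' x)]
      exact Nat.floor_le (mul_nonneg ((hV.1 x).1 z) (hy' x).le)
    have hz₀le : ∀ x, V x (z₀ x) ≤ Vn n x (z₀ x) := by
      intro x
      simp only [Vn, if_true]
      rw [hsplit x]
      exact sub_le_sub_left (Finset.sum_le_sum fun z _ => hfle x z) _
    refine ⟨⟨fun x => ⟨fun z => ?_, ?_⟩, fun x z hp => ?_⟩, ?_⟩
    · by_cases h : z = z₀ x
      · subst h
        exact (hz₀ x).le.trans (hz₀le x)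
      · simp only [Vn, h, if_false]
        exact div_nonneg (Nat.cast_nonneg _) (hy' x).le
    · rw [← Finset.add_sum_erase _ _ (Finset.mem_univ (z₀ x))]
      have : ∑ z ∈ Finset.univ.erase (z₀ x), Vn n x z =
          ∑ z' ∈ Finset.univ.erase (z₀ x), (fl n x z' : ℝ) / (n * Pn n x) :=
        Finset.sum_congr rfl fun z hz => by simp only [Vn, Finset.ne_of_mem_erase hz, if_false]
      rw [this]
      simp only [Vn, if_true]
      ring
    · by_cases h : z = z₀ x
      · subst h
        exact hV.2 _ _ (hz₀ x)
      · simp only [Vn, h, if_false] at hp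
        exact hV.2 _ _ (hp.trans_le (hfle x z))
    · rintro ⟨x, z⟩
      simp only [jointPW]
      obtain ⟨k, hk⟩ := htype x
      by_cases h : z = z₀ x
      · subst h
        have hval : Pn n x * Vn n x (z₀ x) =
            ((k : ℝ) - ∑ z' ∈ Finset.univ.erase (z₀ x), (fl n x z' : ℝ)) / n := by
          have hk' : (k : ℝ) = n * Pn n x := by rw [hk]; field_simp
          simp only [Vn, if_true]
          rw [← Finset.sum_div, hk']
          have := (hpos x).ne'
          field_simp
        have hnn : 0 ≤ Pn n x * Vn n x (z₀ x) :=
          mul_nonneg (hpos x).le ((hz₀ x).le.trans (hz₀le x))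
        refine ⟨k - ∑ z' ∈ Finset.univ.erase (z₀ x), fl n x z', ?_⟩
        rw [hval] at hnn ⊢
        rw [le_div_iff₀ hn', zero_mul, sub_nonneg] at hnn
        rw [Nat.cast_sub (by exact_mod_cast hnn)]
        push_cast
        rfl
      · refine ⟨fl n x z, ?_⟩
        simp only [Vn, h, if_false]
        have := (hpos x).ne'
        field_simp

/-- If `V'` has the same output law as `V` and a larger support, then dominated channels near `V`
whose joint law is an `n`-type are matched by dominated channels near `V'` of the same kind and
with the same output law. -/
lemma exists_matching_types {P_X : 𝒳 → ℝ} (hPpos : ∀ x, 0 < P_X x) {Pn : ℕ → 𝒳 → ℝ}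
    (hPn : ∀ᶠ n in atTop, IsPMF (Pn n) ∧ IsType n (Pn n) ∧ ∀ x, 0 < Pn n x)
    (hconv : Tendsto Pn atTop (𝓝 P_X)) (hV : V ∈ domChannels W) {V' : 𝒳 → 𝒵 → ℝ}
    (hV' : V' ∈ domChannels W) (ho : ∀ z, outDist P_X V' z = outDist P_X V z)
    (hsupp : ∀ x z, 0 < V x z → 0 < V' x z) :
    ∃ F : ℕ × (𝒳 → 𝒵 → ℝ) → 𝒳 → 𝒵 → ℝ,
      Tendsto F (atTop ×ˢ 𝓝[domChannels W] V) (𝓝 V') ∧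
      ∀ᶠ q in atTop ×ˢ 𝓝[domChannels W] V, IsType q.1 (jointPW (Pn q.1) q.2) →
        F q ∈ domChannels W ∧ IsType q.1 (jointPW (Pn q.1) (F q)) ∧
        ∀ z, outDist (Pn q.1) (F q) z = outDist (Pn q.1) q.2 z := by
  classical
  let Δ : 𝒳 × 𝒵 → ℝ := fun p => P_X p.1 * (V' p.1 p.2 - V p.1 p.2)
  obtain ⟨N, hN, hrel⟩ := exists_int_approx Δ
  have hrow : ∀ n x, ∑ z, (N n (x, z) : ℝ) = 0 := by
    intro n x
    have h := hrel (fun p => if p.1 = x then 1 else 0) (by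
      simp only [Fintype.sum_prod_type, Int.cast_ite, Int.cast_one, Int.cast_zero, ite_mul,
        one_mul, zero_mul]
      rw [Finset.sum_eq_single x (fun y _ hy => by simp [hy]) (by simp)]
      simp only [if_true, Δ]
      rw [← Finset.mul_sum, Finset.sum_sub_distrib, (hV'.1 x).2, (hV.1 x).2]
      ring) n
    simp only [Fintype.sum_prod_type, ite_mul, one_mul, zero_mul] at h
    rw [Finset.sum_eq_single x (fun y _ hy => by simp [hy]) (by simp)] at h
    simp only [if_true] at h
    exact_mod_cast h
  have hcol : ∀ n z, ∑ x, (N n (x, z) : ℝ) = 0 := by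
    intro n z
    have h := hrel (fun p => if p.2 = z then 1 else 0) (by
      simp only [Fintype.sum_prod_type_right, Int.cast_ite, Int.cast_one, Int.cast_zero, ite_mul,
        one_mul, zero_mul]
      rw [Finset.sum_eq_single z (fun y _ hy => by simp [hy]) (by simp)]
      simp only [if_true, Δ]
      have := ho z
      unfold outDist at this
      simp_rw [mul_sub]
      rw [Finset.sum_sub_distrib, this, sub_self]) n
    simp only [Fintype.sum_prod_type_right, ite_mul, one_mul, zero_mul] at h
    rw [Finset.sum_eq_single z (fun y _ hy => by simp [hy]) (by simp)] at h
    simp only [if_true] at h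
    exact_mod_cast h
  have hzero : ∀ n x z, ¬ 0 < V' x z → N n (x, z) = 0 := by
    intro n x z h0
    have hv' : V' x z = 0 := le_antisymm (not_lt.1 h0) ((hV'.1 x).1 z)
    have hv : V x z = 0 := le_antisymm (not_lt.1 fun h => h0 (hsupp x z h)) ((hV.1 x).1 z)
    have h := hrel (fun p => if p = (x, z) then 1 else 0) (by simp [Δ, hv, hv']) n
    simpa using h
  let F : ℕ × (𝒳 → 𝒵 → ℝ) → 𝒳 → 𝒵 → ℝ := fun q x z =>
    q.2 x z + (N q.1 (x, z) : ℝ) / q.1 / Pn q.1 x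
  have hfst : Tendsto (Prod.fst : ℕ × (𝒳 → 𝒵 → ℝ) → ℕ)
      (atTop ×ˢ 𝓝[domChannels W] V) atTop := tendsto_fst
  have hsnd : Tendsto (Prod.snd : ℕ × (𝒳 → 𝒵 → ℝ) → _)
      (atTop ×ˢ 𝓝[domChannels W] V) (𝓝[domChannels W] V) := tendsto_snd
  have hF : ∀ x z, Tendsto (fun q => F q x z) (atTop ×ˢ 𝓝[domChannels W] V) (𝓝 (V' x z)) := by
    intro x z
    have h1 : Tendsto (fun q : ℕ × (𝒳 → 𝒵 → ℝ) => q.2 x z)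
        (atTop ×ˢ 𝓝[domChannels W] V) (𝓝 (V x z)) :=
      tendsto_pi_nhds.1 (tendsto_pi_nhds.1 (tendsto_nhds_of_tendsto_nhdsWithin hsnd) x) z
    have h2 := ((hN (x, z)).div (tendsto_pi_nhds.1 hconv x) (hPpos x).ne').comp hfst
    have h3 := h1.add h2
    have : V x z + Δ (x, z) / P_X x = V' x z := by
      have := (hPpos x).ne'
      simp only [Δ]
      field_simp
      ring
    rw [this] at h3
    exact h3
  refine ⟨F, tendsto_pi_nhds.2 fun x => tendsto_pi_nhds.2 fun z => hF x z, ?_⟩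
  have hpos' : ∀ᶠ q in atTop ×ˢ 𝓝[domChannels W] V, ∀ x z, 0 < V' x z → 0 < F q x z := by
    simp only [eventually_all]
    intro x z hp
    exact (hF x z).eventually (lt_mem_nhds hp)
  filter_upwards [hpos', hfst.eventually hPn, hfst.eventually (eventually_gt_atTop 0),
    hsnd.eventually self_mem_nhdsWithin] with ⟨n, U⟩ hpF ⟨_, _, hP⟩ hn hU ht
  have hn' : (0 : ℝ) < n := by exact_mod_cast hn
  have hFeq : ∀ x z, ¬ 0 < V' x z → F (n, U) x z = U x z := by
    intro x z h
    simp [F, hzero n x z h]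
  have hnn : ∀ x z, 0 ≤ F (n, U) x z := by
    intro x z
    by_cases h : 0 < V' x z
    · exact (hpF x z h).le
    · rw [hFeq x z h]
      exact (hU.1 x).1 z
  refine ⟨⟨fun x => ⟨hnn x, ?_⟩, fun x z hp => ?_⟩, ?_, fun z => ?_⟩
  · simp only [F]
    rw [Finset.sum_add_distrib, (hU.1 x).2, ← Finset.sum_div, ← Finset.sum_div, hrow]
    simp
  · by_cases h : 0 < V' x z
    · exact hV'.2 x z h
    · rw [hFeq x z h] at hp
      exact hU.2 x z hp
  · rintro ⟨x, z⟩
    obtain ⟨k, hk⟩ := ht (x, z)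
    simp only [jointPW] at hk ⊢
    have hval : Pn n x * F (n, U) x z = (((k : ℤ) + N n (x, z) : ℤ) : ℝ) / n := by
      simp only [F]
      rw [mul_add, hk, mul_div_cancel₀ _ (hP x).ne']
      push_cast
      ring
    have h0 : 0 ≤ Pn n x * F (n, U) x z := mul_nonneg (hP x).le (hnn x z)
    rw [hval, le_div_iff₀ hn', zero_mul] at h0
    obtain ⟨m, hm⟩ := Int.eq_ofNat_of_zero_le (by exact_mod_cast h0 : 0 ≤ (k : ℤ) + N n (x, z))
    refine ⟨m, ?_⟩
    rw [hval, hm]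
    simp
  · simp only [F, outDist]
    have : ∀ x, Pn n x * (U x z + (N n (x, z) : ℝ) / n / Pn n x) =
        Pn n x * U x z + (N n (x, z) : ℝ) / n := by
      intro x
      rw [mul_add, mul_div_cancel₀ _ (hP x).ne']
    simp_rw [this]
    rw [Finset.sum_add_distrib, ← Finset.sum_div, hcol]
    simp

lemma eventually_EsCCn_lt {P_X : 𝒳 → ℝ} (hPpos : ∀ x, 0 < P_X x) (hW : IsChannel W) (R : ℝ)
    {Pn : ℕ → 𝒳 → ℝ}
    (hPn : ∀ᶠ n in atTop, IsPMF (Pn n) ∧ IsType n (Pn n) ∧ ∀ x, 0 < Pn n x)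
    (hconv : Tendsto Pn atTop (𝓝 P_X)) {a : EReal} (ha : EsCC P_X W R < a) :
    ∀ᶠ n in atTop, EsCCn n (Pn n) W R < a := by
  obtain ⟨_, ⟨V, hVc, rfl⟩, hlt⟩ := sInf_lt_iff.1 ha
  obtain ⟨a', ha', haa⟩ := EReal.lt_iff_exists_real_btwn.1 hlt
  have hV : V ∈ domChannels W := by
    by_contra h
    rw [condKL_eq_top hPpos hVc h, top_add_max_zero] at ha'
    exact not_top_lt ha'
  rw [condKL_eq hV] at ha'
  set d := condKLReal W P_X V with hd
  set J := omegaEntropy W P_X V with hJ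
  have hda : d < a' := EReal.coe_lt_coe_iff.1 ((coe_le_add_max_zero R d _).trans_lt ha')
  have hc : ∀ V' ∈ domChannels W, (∀ z, outDist P_X V' z = outDist P_X V z) →
      R - a' + d - J < condKLReal W P_X V' := by
    intro V' hV' ho
    have h := (coe_le_add_max (R := R) (d := d) (gFun_le hPpos hV hV' ho)).trans_lt ha'
    have h' := EReal.coe_lt_coe_iff.1 h
    linarith
  obtain ⟨Vn, hVn, hVnt⟩ := exists_type_channels hPpos hPn hconv hV
  have hpair : Tendsto (fun n => (Pn n, Vn n)) atTop (𝓝 (P_X, V)) := hconv.prodMk_nhds hVn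
  have hev : ∀ᶠ u : (𝒳 → ℝ) × (𝒳 → 𝒵 → ℝ) in 𝓝 (P_X, V), ∀ V' ∈ domChannels W,
      (∀ z, outDist u.1 V' z = outDist u.1 u.2 z) → R - a' + d - J < condKLReal W u.1 V' := by
    refine (isCompact_domChannels W hW).eventually_forall_of_forall_eventually fun V' hV' => ?_
    have hq : Continuous fun v : ((𝒳 → ℝ) × (𝒳 → 𝒵 → ℝ)) × (𝒳 → 𝒵 → ℝ) => (v.1.1, v.2) := by
      fun_prop
    by_cases ho : ∀ z, outDist P_X V' z = outDist P_X V z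
    · have := (((continuous_condKLReal W).comp hq).tendsto ((P_X, V), V')).eventually
        (lt_mem_nhds (hc V' hV' ho))
      exact this.mono fun v hv _ => hv
    · push Not at ho
      obtain ⟨z, hz⟩ := ho
      have h1 := ((continuous_outDist z).comp hq).tendsto ((P_X, V), V')
      have h2 := ((continuous_outDist z).comp continuous_fst).tendsto ((P_X, V), V')
      exact ((h1.sub h2).eventually_ne (sub_ne_zero.2 hz)).mono fun v hv h => (hv (sub_eq_zero.2 (h z))).elim
  have hlim : Tendsto (fun n => condKLReal W (Pn n) (Vn n) +
      max (R - (omegaEntropy W (Pn n) (Vn n) + (R - a' + d - J))) 0) atTop (𝓝 a') := by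
    have h1 := ((continuous_condKLReal W).tendsto _).comp hpair
    have h2 := ((continuous_omegaEntropy W).tendsto _).comp hpair
    have h3 := h1.add (((tendsto_const_nhds (x := R)).sub
      (h2.add_const (R - a' + d - J))).max (tendsto_const_nhds (x := (0 : ℝ))))
    have h4 : d + max (R - (J + (R - a' + d - J))) 0 = a' := by
      rw [show R - (J + (R - a' + d - J)) = a' - d by ring, max_eq_left (by linarith)]
      ring
    rw [← hd, ← hJ, h4] at h3
    exact h3
  have hlim' := (continuous_coe_real_ereal.tendsto a').comp hlim
  filter_upwards [hlim'.eventually (gt_mem_nhds haa), hVnt, hPn, hpair.eventually hev]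
    with n h1 ⟨h2, h3⟩ ⟨_, _, hP⟩ h4
  refine lt_of_le_of_lt ?_ h1
  refine (EsCCn_le h2.1 h3).trans ?_
  rw [condKL_eq h2]
  exact add_max_le_coe ((le_gFun hP h2 fun V' hV' ho => (h4 V' hV' ho).le).trans
    (gFun_le_gFunN n hP h2))

lemma eventually_lt_EsCCn {P_X : 𝒳 → ℝ} (hPpos : ∀ x, 0 < P_X x) (hW : IsChannel W) (R : ℝ)
    {Pn : ℕ → 𝒳 → ℝ}
    (hPn : ∀ᶠ n in atTop, IsPMF (Pn n) ∧ IsType n (Pn n) ∧ ∀ x, 0 < Pn n x)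
    (hconv : Tendsto Pn atTop (𝓝 P_X)) {b : EReal} (hb : b < EsCC P_X W R) :
    ∀ᶠ n in atTop, b < EsCCn n (Pn n) W R := by
  obtain ⟨b', hbb, hb'⟩ := EReal.lt_iff_exists_real_btwn.1 hb
  have key : ∀ᶠ n in atTop, ∀ U ∈ domChannels W, IsType n (jointPW (Pn n) U) →
      (b' : EReal) ≤ condKL U W (Pn n) + max ((R : EReal) - gFunN n U W (Pn n)) 0 := by
    refine (isCompact_domChannels W hW).eventually_forall_of_prod fun V hV => ?_
    have hfst : Tendsto (Prod.fst : ℕ × (𝒳 → 𝒵 → ℝ) → ℕ)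
        (atTop ×ˢ 𝓝[domChannels W] V) atTop := tendsto_fst
    have hsnd : Tendsto (Prod.snd : ℕ × (𝒳 → 𝒵 → ℝ) → _)
        (atTop ×ˢ 𝓝[domChannels W] V) (𝓝[domChannels W] V) := tendsto_snd
    have hpair : Tendsto (fun q : ℕ × (𝒳 → 𝒵 → ℝ) => (Pn q.1, q.2))
        (atTop ×ˢ 𝓝[domChannels W] V) (𝓝 (P_X, V)) :=
      (hconv.comp hfst).prodMk_nhds (tendsto_nhds_of_tendsto_nhdsWithin hsnd)
    have hmem := hsnd.eventually self_mem_nhdsWithin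
    have hd := ((continuous_condKLReal W).tendsto _).comp hpair
    by_cases hbd : b' < condKLReal W P_X V
    · filter_upwards [hd.eventually (lt_mem_nhds hbd), hmem] with q hq hU _
      rw [condKL_eq hU]
      exact (EReal.coe_le_coe_iff.2 hq.le).trans (coe_le_add_max_zero _ _ _)
    · obtain ⟨V', hV', ho, hlt⟩ : ∃ V' ∈ domChannels W,
          (∀ z, outDist P_X V' z = outDist P_X V z) ∧
          b' < condKLReal W P_X V + (R - (omegaEntropy W P_X V + condKLReal W P_X V')) := by
        by_contra! hcon
        refine absurd hb' (not_lt.2 ((EsCC_le hV.1).trans ?_))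
        rw [condKL_eq hV]
        refine (add_max_le_coe (le_gFun hPpos hV
          (c := condKLReal W P_X V + R - omegaEntropy W P_X V - b')
          fun V' hV' ho => by linarith [hcon V' hV' ho])).trans ?_
        rw [EReal.coe_le_coe_iff, max_eq_left (by linarith [not_lt.1 hbd])]
        linarith
      obtain ⟨t, ht0, ht1, hlt'⟩ : ∃ t : ℝ, 0 < t ∧ t < 1 ∧
          b' < condKLReal W P_X V +
            (R - (omegaEntropy W P_X V + condKLReal W P_X (V' + t • (V - V')))) := by
        have hcont : Continuous fun t : ℝ => condKLReal W P_X V +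
            (R - (omegaEntropy W P_X V + condKLReal W P_X (V' + t • (V - V')))) := by
          have : Continuous fun t : ℝ => condKLReal W P_X (V' + t • (V - V')) :=
            (continuous_condKLReal W).comp (by fun_prop :
              Continuous fun t : ℝ => (P_X, V' + t • (V - V')))
          fun_prop
        have h0 := (hcont.tendsto 0).eventually (lt_mem_nhds (by simpa using hlt))
        obtain ⟨t, h1, h2⟩ := ((h0.filter_mono nhdsWithin_le_nhds).and
          (Ioo_mem_nhdsGT (zero_lt_one' ℝ))).exists
        exact ⟨t, h2.1, h2.2, h1⟩
      have happ : ∀ x z, (V' + t • (V - V')) x z = t * V x z + (1 - t) * V' x z := by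
        intro x z
        simp only [Pi.add_apply, Pi.smul_apply, Pi.sub_apply, smul_eq_mul]
        ring
      have ht1' : 0 < 1 - t := by linarith
      obtain ⟨F, hF, hFev⟩ := exists_matching_types (V' := V' + t • (V - V'))
        hPpos hPn hconv hV
        (by
          refine ⟨fun x => ⟨fun z => ?_, ?_⟩, fun x z hp => ?_⟩
          · rw [happ]
            exact add_nonneg (mul_nonneg ht0.le ((hV.1 x).1 z))
              (mul_nonneg ht1'.le ((hV'.1 x).1 z))
          · simp_rw [happ]
            rw [Finset.sum_add_distrib, ← Finset.mul_sum, ← Finset.mul_sum, (hV.1 x).2,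
              (hV'.1 x).2]
            ring
          · by_contra hw
            have h1 := not_lt.1 (mt (hV.2 x z) hw)
            have h2 := not_lt.1 (mt (hV'.2 x z) hw)
            rw [happ] at hp
            nlinarith)
        (by
          intro z
          have := ho z
          simp only [outDist] at this ⊢
          simp_rw [happ, mul_add, mul_left_comm (P_X _)]
          rw [Finset.sum_add_distrib, ← Finset.mul_sum, ← Finset.mul_sum, this]
          ring)
        (by
          intro x z hp
          rw [happ]
          exact add_pos_of_pos_of_nonneg (mul_pos ht0 hp) (mul_nonneg ht1'.le ((hV'.1 x).1 z)))
      have hJ := ((continuous_omegaEntropy W).tendsto _).comp hpair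
      have hd' := ((continuous_condKLReal W).tendsto _).comp
        ((hconv.comp hfst).prodMk_nhds hF)
      have hlim := hd.add ((tendsto_const_nhds (x := R)).sub (hJ.add hd'))
      filter_upwards [hlim.eventually (lt_mem_nhds hlt'), hmem, hFev, hfst.eventually hPn]
        with q hq hU hFq ⟨_, _, hP⟩ ht
      obtain ⟨h1, h2, h3⟩ := hFq ht
      rw [condKL_eq hU]
      exact (EReal.coe_le_coe_iff.2 hq.le).trans
        (coe_le_add_max (gFunN_le hP hU h1 h2 h3))
  filter_upwards [key, hPn] with n hn ⟨_, _, hP⟩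
  refine hbb.trans_le (le_sInf ?_)
  rintro _ ⟨U, hUc, hUt, rfl⟩
  by_cases hU : U ∈ domChannels W
  · exact hn U hU hUt
  · rw [condKL_eq_top hP hUc hU, top_add_max_zero]
    exact le_top

end Exponent

theorem exact_cc_exponent_limit
    {𝒳 𝒵 : Type*} [Fintype 𝒳] [Fintype 𝒵] [Nonempty 𝒳] [Nonempty 𝒵]
    (P_X : 𝒳 → ℝ) (W : 𝒳 → 𝒵 → ℝ)
    (hP : IsPMF P_X) (hPpos : ∀ x, 0 < P_X x) (hW : IsChannel W) (R : ℝ)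
    (Pn : ℕ → 𝒳 → ℝ)
    (hPn : ∀ᶠ n in atTop,
      IsPMF (Pn n) ∧ IsType n (Pn n) ∧ ∀ x, 0 < Pn n x)
    (hconv : Tendsto (fun n => ∑ x, |Pn n x - P_X x|) atTop (nhds 0)) :
    Tendsto (fun n => EsCCn n (Pn n) W R) atTop (nhds (EsCC P_X W R)) := by
  have hc : Tendsto Pn atTop (nhds P_X) := by
    refine tendsto_pi_nhds.2 fun x => tendsto_iff_dist_tendsto_zero.2 ?_
    refine squeeze_zero (fun _ => dist_nonneg) (fun n => ?_) hconv
    rw [Real.dist_eq]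
    exact Finset.single_le_sum (f := fun x => |Pn n x - P_X x|) (fun _ _ => abs_nonneg _)
      (Finset.mem_univ x)
  exact tendsto_order.2 ⟨fun _ h => eventually_lt_EsCCn hPpos hW R hPn hc h,
    fun _ h => eventually_EsCCn_lt hPpos hW R hPn hc h⟩

end
end

section
/- Fix finite nonempty sets 𝒳, 𝒵, a pmf P_X on 𝒳, and a channel W from 𝒳 to 𝒵. Define g(V‖W|P_X) := ω(V‖W|P_X) + H(P_X∘V) + min{ D(V'‖W|P_X) : V' a channel with P_X∘V' = P_X∘V }, E_s^cc(P_X,W,R) := min over channels V of { D(V‖W|P_X) + max(R − g(V‖W|P_X), 0) }, and E_0(P_X,W,λ) := ln Σ_z ( Σ_x P_X(x) W(z|x)^{1/(1−λ)} )^{1−λ}. Then for every real R and every λ ∈ [0,1), E_s^cc(P_X,W,R) ≥ λR − E_0(P_X,W,λ). -/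
open Filter

noncomputable section

/-- Gallager's function `E₀(P,W,λ) = ln Σ_z ( Σ_x P(x) W(z|x)^{1/(1−λ)} )^{1−λ}`. -/
def E0 {𝒳 𝒵 : Type*} [Fintype 𝒳] [Fintype 𝒵] (P : 𝒳 → ℝ) (W : 𝒳 → 𝒵 → ℝ) (lam : ℝ) : ℝ :=
  Real.log (∑ z, (∑ x, P x * (W x z) ^ (1 / (1 - lam))) ^ (1 - lam))

/-- Pointwise form of Gallager's bound: the tangent-line estimate `log t ≤ t - 1`, applied to the
two likelihood ratios `q p w^(1/(1-l)) / (p v s)` and `s^(1-l) / (q t)`. -/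
lemma gallager_pointwise {p v w q s t l : ℝ} (hp : 0 < p) (hv : 0 < v) (hw : 0 < w)
    (hq : 0 < q) (hs : 0 < s) (ht : 0 < t) (hl : l < 1) :
    p * v * (Real.log w - l * Real.log q - (1 - l) * Real.log v) ≤
      p * v * Real.log t + (1 - l) * (q * (p * w ^ (1 / (1 - l)) / s) - p * v)
        + (p * v / q * (s ^ (1 - l) / t) - p * v) := by
  have hl' : 0 < 1 - l := by linarith
  have hwa : 0 < w ^ (1 / (1 - l)) := Real.rpow_pos_of_pos hw _
  have hsa : 0 < s ^ (1 - l) := Real.rpow_pos_of_pos hs _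
  have h1 := Real.log_le_sub_one_of_pos
    (show 0 < q * w ^ (1 / (1 - l)) / (v * s) by positivity)
  have h2 := Real.log_le_sub_one_of_pos (show 0 < s ^ (1 - l) / (q * t) by positivity)
  rw [Real.log_div (by positivity) (by positivity), Real.log_mul hq.ne' hwa.ne',
    Real.log_mul hv.ne' hs.ne', Real.log_rpow hw] at h1
  rw [Real.log_div hsa.ne' (by positivity), Real.log_mul hq.ne' ht.ne', Real.log_rpow hs] at h2
  have h3 := mul_le_mul_of_nonneg_left h1 hl'.le
  have h4 : (1 - l) * (1 / (1 - l) * Real.log w) = Real.log w := by field_simp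
  have h5 : Real.log w - l * Real.log q - (1 - l) * Real.log v ≤
      Real.log t + (1 - l) * (q * w ^ (1 / (1 - l)) / (v * s) - 1)
        + (s ^ (1 - l) / (q * t) - 1) := by linarith
  refine (mul_le_mul_of_nonneg_left h5 (mul_pos hp hv).le).trans_eq ?_
  field_simp

/-- Gallager's bound for a channel `V`, in terms of `H(P∘V)`, `ω(V‖W|P)` and the conditional
entropy of `V` given `P`. -/
lemma sum_le_E0 {𝒳 𝒵 : Type*} [Fintype 𝒳] [Fintype 𝒵] {P : 𝒳 → ℝ} {V W : 𝒳 → 𝒵 → ℝ}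
    (hP : IsPMF P) (hV : IsChannel V) (hW : IsChannel W)
    (hac : ∀ x z, 0 < P x → 0 < V x z → 0 < W x z) {l : ℝ} (hl : l < 1) :
    ∑ z, ∑ x, P x * V x z *
      (Real.log (W x z) - l * Real.log (outDist P V z) - (1 - l) * Real.log (V x z)) ≤
      E0 P W l := by
  set S : 𝒵 → ℝ := fun z => ∑ x, P x * (W x z) ^ (1 / (1 - l)) with hS
  set T : ℝ := ∑ z, S z ^ (1 - l) with hT
  set Q : 𝒵 → ℝ := outDist P V with hQ
  have hl' : 0 < 1 - l := by linarith
  have hSterm : ∀ x z, 0 ≤ P x * (W x z) ^ (1 / (1 - l)) := fun x z =>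
    mul_nonneg (hP.1 x) (Real.rpow_nonneg ((hW x).1 z) _)
  have hS0 : ∀ z, 0 ≤ S z := fun z => Finset.sum_nonneg fun x _ => hSterm x z
  have hST : ∀ z, 0 ≤ S z ^ (1 - l) := fun z => Real.rpow_nonneg (hS0 z) _
  have hT0 : 0 ≤ T := Finset.sum_nonneg fun z _ => hST z
  have hJ0 : ∀ x z, 0 ≤ P x * V x z := fun x z => mul_nonneg (hP.1 x) ((hV x).1 z)
  have hQ0 : ∀ z, 0 ≤ Q z := fun z => Finset.sum_nonneg fun x _ => hJ0 x z
  have hQsum : ∑ z, Q z = 1 := by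
    simp only [hQ, outDist]
    rw [Finset.sum_comm]
    simp_rw [← Finset.mul_sum, (hV _).2, mul_one, hP.2]
  have hterm : ∀ z x, P x * V x z *
      (Real.log (W x z) - l * Real.log (Q z) - (1 - l) * Real.log (V x z)) ≤
      P x * V x z * Real.log T
        + (1 - l) * (Q z * (P x * (W x z) ^ (1 / (1 - l)) / S z) - P x * V x z)
        + (P x * V x z / Q z * (S z ^ (1 - l) / T) - P x * V x z) := by
    intro z x
    rcases (hJ0 x z).eq_or_lt with h | h
    · rw [← h]
      have h1 := mul_nonneg hl'.le (mul_nonneg (hQ0 z) (div_nonneg (hSterm x z) (hS0 z)))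
      simpa using h1
    · have hp : 0 < P x := pos_of_mul_pos_left h ((hV x).1 z)
      have hv : 0 < V x z := pos_of_mul_pos_right h (hP.1 x)
      have hw := hac x z hp hv
      have hq : 0 < Q z := h.trans_le
        (Finset.single_le_sum (fun x _ => hJ0 x z) (Finset.mem_univ x))
      have hs : 0 < S z := (mul_pos hp (Real.rpow_pos_of_pos hw _)).trans_le
        (Finset.single_le_sum (fun x _ => hSterm x z) (Finset.mem_univ x))
      have ht : 0 < T := (Real.rpow_pos_of_pos hs _).trans_le
        (Finset.single_le_sum (fun z _ => hST z) (Finset.mem_univ z))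
      exact gallager_pointwise hp hv hw hq hs ht hl
  have hrow : ∀ z, ∑ x, P x * V x z *
      (Real.log (W x z) - l * Real.log (Q z) - (1 - l) * Real.log (V x z)) ≤
      Q z * Real.log T + (S z ^ (1 - l) / T - Q z) := by
    intro z
    refine (Finset.sum_le_sum fun x _ => hterm z x).trans ?_
    have e : ∑ x, P x * V x z = Q z := rfl
    have e' : ∑ x, P x * (W x z) ^ (1 / (1 - l)) = S z := rfl
    simp only [Finset.sum_add_distrib, Finset.sum_sub_distrib, ← Finset.mul_sum,
      ← Finset.sum_mul, ← Finset.sum_div, e, e']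
    have h1 : Q z * (S z / S z) ≤ Q z := mul_le_of_le_one_right (hQ0 z) (div_self_le_one _)
    have h2 : Q z / Q z * (S z ^ (1 - l) / T) ≤ S z ^ (1 - l) / T :=
      mul_le_of_le_one_left (div_nonneg (hST z) hT0) (div_self_le_one _)
    have h3 : (1 - l) * (Q z * (S z / S z) - Q z) ≤ 0 :=
      mul_nonpos_of_nonneg_of_nonpos hl'.le (by linarith)
    linarith
  refine (Finset.sum_le_sum fun z _ => hrow z).trans ?_
  rw [Finset.sum_add_distrib, Finset.sum_sub_distrib, ← Finset.sum_mul, ← Finset.sum_div, hQsum,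
    ← hT, one_mul]
  have h4 : T / T ≤ 1 := div_self_le_one _
  have h5 : E0 P W l = Real.log T := rfl
  linarith

lemma omega_sum_eq {𝒳 𝒵 : Type*} [Fintype 𝒳] [Fintype 𝒵] {P : 𝒳 → ℝ} {V : 𝒳 → 𝒵 → ℝ}
    (W : 𝒳 → 𝒵 → ℝ) (hP : IsPMF P) (hV : IsChannel V) :
    (∑ p : 𝒳 × 𝒵, if 0 < P p.1 * V p.1 p.2 then
        P p.1 * V p.1 p.2 * Real.log (W p.1 p.2) else 0) =
      ∑ z, ∑ x, P x * V x z * Real.log (W x z) := by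
  rw [Fintype.sum_prod_type_right]
  refine Finset.sum_congr rfl fun z _ => Finset.sum_congr rfl fun x _ => ?_
  rcases (mul_nonneg (hP.1 x) ((hV x).1 z)).eq_or_lt with h | h
  · simp [← h]
  · simp [h]

lemma entropy_outDist_eq {𝒳 𝒵 : Type*} [Fintype 𝒳] [Fintype 𝒵] {P : 𝒳 → ℝ} {V : 𝒳 → 𝒵 → ℝ}
    (hP : IsPMF P) (hV : IsChannel V) :
    entropy (outDist P V) = -∑ z, ∑ x, P x * V x z * Real.log (outDist P V z) := by
  unfold entropy
  congr 1
  refine Finset.sum_congr rfl fun z _ => ?_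
  have h0 : 0 ≤ outDist P V z :=
    Finset.sum_nonneg fun x _ => mul_nonneg (hP.1 x) ((hV x).1 z)
  rw [← Finset.sum_mul]
  change _ = outDist P V z * _
  rcases h0.eq_or_lt with h | h
  · simp [← h]
  · simp [h]

lemma condKL_sum_eq {𝒳 𝒵 : Type*} [Fintype 𝒳] [Fintype 𝒵] {P : 𝒳 → ℝ} {V W : 𝒳 → 𝒵 → ℝ}
    (hP : IsPMF P) (hV : IsChannel V) (hac : ∀ x z, 0 < P x → 0 < V x z → 0 < W x z) :
    ∑ x, P x * klDiv (V x) (W x) =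
      ∑ z, ∑ x, P x * V x z * (Real.log (V x z) - Real.log (W x z)) := by
  rw [Finset.sum_comm]
  refine Finset.sum_congr rfl fun x _ => ?_
  rw [klDiv, Finset.mul_sum]
  refine Finset.sum_congr rfl fun z _ => ?_
  rcases (hP.1 x).eq_or_lt with hp | hp
  · simp [← hp]
  rcases ((hV x).1 z).eq_or_lt with hv | hv
  · simp [← hv]
  · rw [if_pos hv, Real.log_div hv.ne' (hac x z hp hv).ne', mul_assoc]

theorem EsCC_ge_gallager_lower_bound
    {𝒳 𝒵 : Type*} [Fintype 𝒳] [Fintype 𝒵] [Nonempty 𝒳] [Nonempty 𝒵]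
    (P_X : 𝒳 → ℝ) (W : 𝒳 → 𝒵 → ℝ) (hP : IsPMF P_X) (hW : IsChannel W)
    (R lam : ℝ) (hlam0 : 0 ≤ lam) (hlam1 : lam < 1) :
    ((lam * R - E0 P_X W lam : ℝ) : EReal) ≤ EsCC P_X W R := by
  refine le_sInf ?_
  rintro _ ⟨V, hV, rfl⟩
  by_cases hac : ∀ x z, 0 < P_X x → 0 < V x z → 0 < W x z
  swap
  · have hmax : max ((R : EReal) - gFun V W P_X) 0 ≠ ⊥ :=
      ((EReal.bot_lt_zero).trans_le (le_max_right _ _)).ne'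
    rw [condKL, if_neg hac, EReal.top_add_of_ne_bot hmax]
    exact le_top
  have hD : condKL V W P_X = ((∑ x, P_X x * klDiv (V x) (W x) : ℝ) : EReal) := if_pos hac
  have hom : omegaF V W P_X = ((∑ z, ∑ x, P_X x * V x z * Real.log (W x z) : ℝ) : EReal) := by
    rw [← omega_sum_eq W hP hV]
    exact if_pos fun x z h =>
      hac x z (pos_of_mul_pos_left h ((hV x).1 z)) (pos_of_mul_pos_right h (hP.1 x))
  set D : ℝ := ∑ x, P_X x * klDiv (V x) (W x) with hDdef
  set om : ℝ := ∑ z, ∑ x, P_X x * V x z * Real.log (W x z) with homdef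
  set H : ℝ := entropy (outDist P_X V) with hHdef
  have hg : gFun V W P_X ≤ ((om + H + D : ℝ) : EReal) := by
    rw [gFun, hom, EReal.coe_add, EReal.coe_add]
    exact add_le_add le_rfl (sInf_le ⟨V, hV, fun _ => rfl, hD.symm⟩)
  have hkey : lam * (om + H + D) - D ≤ E0 P_X W lam := by
    refine le_trans (le_of_eq ?_) (sum_le_E0 hP hV hW hac hlam1)
    rw [hDdef, condKL_sum_eq hP hV hac, hHdef, entropy_outDist_eq hP hV, homdef]
    simp only [mul_sub, Finset.sum_sub_distrib, mul_left_comm _ lam, mul_left_comm _ (1 - lam),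
      ← Finset.mul_sum]
    ring
  have hreal : lam * R - E0 P_X W lam ≤ D + max (R - (om + H + D)) 0 := by
    have h1 : lam * (R - (om + H + D)) ≤ max (R - (om + H + D)) 0 :=
      (mul_le_mul_of_nonneg_left (le_max_left _ _) hlam0).trans
        (mul_le_of_le_one_left (le_max_right _ _) hlam1.le)
    linarith
  rw [hD]
  calc ((lam * R - E0 P_X W lam : ℝ) : EReal)
      ≤ ((D + max (R - (om + H + D)) 0 : ℝ) : EReal) := EReal.coe_le_coe_iff.2 hreal
    _ = (D : EReal) + max ((R : EReal) - ((om + H + D : ℝ) : EReal)) 0 := by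
        rw [EReal.coe_add, EReal.coe_strictMono.monotone.map_max, EReal.coe_sub, EReal.coe_zero]
    _ ≤ _ := add_le_add le_rfl (max_le_max (EReal.sub_le_sub le_rfl hg) le_rfl)

end
end

section
/- Let A be a nonnegative real-valued random variable on a probability space with E[A²] < ∞ and E[A] > 0. For θ > 0 define c(θ) := ((1+θ)ln(1+θ) − θ)/θ² and τ_θ(A) := E[A]·[ θ² · P(A > (θ+1)E[A]) + 2 ∫_θ^∞ v · P(A > (v+1)E[A]) dv ]. Then for every θ > 0, c(θ) · ( Var(A)/E[A] − τ_θ(A) ) ≤ E[ A ln(A / E[A]) ], where in the expectation the integrand is taken to be 0 on the event {A = 0}. -/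
open MeasureTheory

lemma Real.log_le_sub_inv_div_two {x : ℝ} (hx : 1 ≤ x) : Real.log x ≤ (x - x⁻¹) / 2 := by
  rw [← Real.sinh_log (by positivity)]
  exact Real.self_le_sinh_iff.2 (Real.log_nonneg hx)

lemma Real.half_sq_sub_one_le_mul_log {x : ℝ} (hx0 : 0 ≤ x) (hx1 : x ≤ 1) :
    (x ^ 2 - 1) / 2 ≤ x * Real.log x := by
  rcases hx0.eq_or_lt with rfl | hx
  · norm_num
  have h := Real.log_le_sub_inv_div_two ((one_le_inv₀ hx).2 hx1)
  rw [Real.log_inv, inv_inv] at h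
  have h' := mul_le_mul_of_nonneg_left h hx0
  have e : x * ((x⁻¹ - x) / 2) = (1 - x ^ 2) / 2 := by field_simp
  rw [e] at h'
  linarith

lemma Real.antitoneOn_one_add_mul_log_sub_div_sq :
    AntitoneOn (fun u : ℝ => ((1 + u) * Real.log (1 + u) - u) / u ^ 2) (Set.Ioi 0) := by
  have hd : ∀ u : ℝ, 0 < u →
      HasDerivAt (fun u : ℝ => ((1 + u) * Real.log (1 + u) - u) / u ^ 2)
        ((Real.log (1 + u) * u ^ 2 - ((1 + u) * Real.log (1 + u) - u) * (2 * u)) / (u ^ 2) ^ 2)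
        u := by
    intro u hu
    have h1 : HasDerivAt (fun u : ℝ => 1 + u) 1 u := (hasDerivAt_id u).const_add 1
    have h2 := ((h1.mul (h1.log (by positivity))).sub (hasDerivAt_id u)).div
      (hasDerivAt_pow 2 u) (by positivity)
    refine h2.congr_deriv ?_
    have : (1 + u) ≠ 0 := by positivity
    simp
    field_simp
    ring
  apply antitoneOn_of_deriv_nonpos (convex_Ioi 0)
  · exact fun u hu => (hd u hu).continuousAt.continuousWithinAt
  · rw [interior_Ioi]
    exact fun u hu => (hd u hu).differentiableAt.differentiableWithinAt
  · rw [interior_Ioi]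
    intro u hu
    have hu : 0 < u := hu
    rw [(hd u hu).deriv]
    apply div_nonpos_of_nonpos_of_nonneg _ (by positivity)
    have h := Real.le_log_one_add_of_nonneg hu.le
    rw [div_le_iff₀ (by positivity)] at h
    nlinarith

lemma Real.mul_log_sub_add_one_nonneg {x : ℝ} (hx : 0 ≤ x) : 0 ≤ x * Real.log x - x + 1 := by
  rcases hx.eq_or_lt with rfl | hx
  · norm_num
  have h := mul_le_mul_of_nonneg_left (Real.one_sub_inv_le_log_of_pos hx) hx.le
  rw [mul_sub, mul_inv_cancel₀ hx.ne'] at h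
  linarith

lemma Real.mul_sub_one_sq_le_mul_log_sub_add_one {θ x : ℝ} (hθ : 0 < θ) (hx : 0 ≤ x)
    (hxθ : x ≤ 1 + θ) :
    ((1 + θ) * Real.log (1 + θ) - θ) / θ ^ 2 * (x - 1) ^ 2 ≤ x * Real.log x - x + 1 := by
  rcases le_or_gt x 1 with h1 | h1
  · have hc : ((1 + θ) * Real.log (1 + θ) - θ) / θ ^ 2 ≤ 1 / 2 := by
      rw [div_le_iff₀ (by positivity)]
      have h := mul_le_mul_of_nonneg_left
        (Real.log_le_sub_inv_div_two (x := 1 + θ) (by linarith)) (by positivity : 0 ≤ 1 + θ)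
      have e : (1 + θ) * ((1 + θ - (1 + θ)⁻¹) / 2) = ((1 + θ) ^ 2 - 1) / 2 := by field_simp
      rw [e] at h
      linarith
    have h2 := Real.half_sq_sub_one_le_mul_log hx h1
    have h3 := mul_le_mul_of_nonneg_right hc (sq_nonneg (x - 1))
    linarith
  · have hu : 0 < x - 1 := by linarith
    have h := Real.antitoneOn_one_add_mul_log_sub_div_sq (Set.mem_Ioi.2 hu) (Set.mem_Ioi.2 hθ)
      (by linarith)
    simp only [add_sub_cancel] at h
    rw [le_div_iff₀ (by positivity)] at h
    linarith

lemma integral_indicator_sq_eq_integral_meas_lt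
    {Ω : Type*} [MeasurableSpace Ω] (μ : Measure Ω) [IsFiniteMeasure μ]
    {U : Ω → ℝ} (hU : Measurable U) (hU2 : Integrable (fun ω => U ω ^ 2) μ)
    {θ : ℝ} (hθ : 0 < θ) :
    ∫ ω, {ω | θ < U ω}.indicator (fun ω => U ω ^ 2) ω ∂μ
      = θ ^ 2 * (μ {ω | θ < U ω}).toReal
        + 2 * ∫ v in Set.Ioi θ, v * (μ {ω | v < U ω}).toReal := by
  have hS : MeasurableSet {ω | θ < U ω} := measurableSet_lt measurable_const hU
  have hmeas : Measurable fun v : ℝ => (μ {ω | v < U ω}).toReal := by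
    apply Antitone.measurable
    intro a b hab
    exact ENNReal.toReal_mono (measure_ne_top _ _)
      (measure_mono fun ω (h : b < U ω) => lt_of_le_of_lt hab h)
  have key : ∫ ω, {ω | θ < U ω}.indicator (fun ω => U ω ^ 2 - θ ^ 2) ω ∂μ
      = 2 * ∫ v in Set.Ioi θ, v * (μ {ω | v < U ω}).toReal := by
    have hlc := lintegral_comp_eq_lintegral_meas_lt_mul μ (f := fun ω => max (U ω - θ) 0)
      (g := fun t => 2 * (t + θ)) (Filter.Eventually.of_forall fun ω => le_max_right _ _)
      ((hU.sub_const θ).max measurable_const).aemeasurable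
      (fun t _ => (by fun_prop : Continuous fun t : ℝ => 2 * (t + θ)).intervalIntegrable _ _)
      (by
        filter_upwards [self_mem_ae_restrict measurableSet_Ioi] with t ht
        have : 0 < t := ht
        positivity)
    have hG : ∀ x : ℝ, ∫ t in (0 : ℝ)..x, 2 * (t + θ) = x ^ 2 + 2 * θ * x := by
      intro x
      rw [intervalIntegral.integral_const_mul, intervalIntegral.integral_add
        (by simp) (by simp)]
      simp
      ring
    have hind : ∀ ω, {ω | θ < U ω}.indicator (fun ω => U ω ^ 2 - θ ^ 2) ω
        = (max (U ω - θ) 0) ^ 2 + 2 * θ * max (U ω - θ) 0 := by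
      intro ω
      by_cases h : θ < U ω
      · rw [Set.indicator_of_mem (by exact h), max_eq_left (by linarith)]
        ring
      · rw [Set.indicator_of_notMem (by exact h), max_eq_right (by linarith)]
        ring
    simp only [hG] at hlc
    have hpos : ∀ ω, 0 ≤ (max (U ω - θ) 0) ^ 2 + 2 * θ * max (U ω - θ) 0 := fun ω => by
      have := le_max_right (U ω - θ) 0
      positivity
    have hshift : ∫ v in Set.Ioi θ, v * (μ {ω | v < U ω}).toReal
        = ∫ t in Set.Ioi 0, (t + θ) * (μ {ω | t + θ < U ω}).toReal := by
      have := (measurePreserving_add_right volume θ).setIntegral_preimage_emb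
        (measurableEmbedding_addRight θ) (fun v => v * (μ {ω | v < U ω}).toReal) (Set.Ioi θ)
      simpa using this.symm
    simp only [hind]
    rw [hshift, ← integral_const_mul, integral_eq_lintegral_of_nonneg_ae
      (Filter.Eventually.of_forall hpos) (by fun_prop), hlc,
      integral_eq_lintegral_of_nonneg_ae]
    · congr 1
      apply setLIntegral_congr_fun measurableSet_Ioi
      intro t ht
      have ht : 0 < t := ht
      have hset : {ω | t < max (U ω - θ) 0} = {ω | t + θ < U ω} := by
        ext ω
        simp only [Set.mem_ofPred_eq, lt_max_iff, ht.not_gt, or_false, lt_sub_iff_add_lt]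
      simp only [hset]
      rw [← mul_assoc 2, ENNReal.ofReal_mul (p := 2 * (t + θ)) (by positivity),
        ENNReal.ofReal_toReal (measure_ne_top _ _), mul_comm]
    · filter_upwards [self_mem_ae_restrict measurableSet_Ioi] with t ht
      have : 0 < t := ht
      simp only [Pi.zero_apply]
      positivity
    · have := hmeas.comp (measurable_id.add_const θ)
      exact (((measurable_id.add_const θ).mul this).const_mul 2).aestronglyMeasurable
  rw [← key, integral_indicator hS, integral_indicator hS,
    integral_sub hU2.integrableOn (integrable_const _)]
  simp [Measure.real, mul_comm]

theorem lower_bound_integral_mul_log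
    {Ω : Type*} [MeasurableSpace Ω] (μ : Measure Ω) [IsProbabilityMeasure μ]
    (A : Ω → ℝ) (hA : Measurable A) (hA0 : ∀ ω, 0 ≤ A ω)
    (hA2 : Integrable (fun ω => (A ω) ^ 2) μ)
    (hmean : 0 < ∫ ω, A ω ∂μ)
    (θ : ℝ) (hθ : 0 < θ) :
    (((1 + θ) * Real.log (1 + θ) - θ) / θ ^ 2) *
        (((∫ ω, (A ω) ^ 2 ∂μ) - (∫ ω, A ω ∂μ) ^ 2) / (∫ ω, A ω ∂μ)
          - (∫ ω, A ω ∂μ) *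
              (θ ^ 2 * (μ {ω | (θ + 1) * ∫ ω', A ω' ∂μ < A ω}).toReal
                + 2 * ∫ v in Set.Ioi θ,
                    v * (μ {ω | (v + 1) * ∫ ω', A ω' ∂μ < A ω}).toReal))
      ≤ ∫ ω, A ω * Real.log (A ω / ∫ ω', A ω' ∂μ) ∂μ := by
  set m := ∫ ω, A ω ∂μ with hm
  set c := ((1 + θ) * Real.log (1 + θ) - θ) / θ ^ 2
  have hAint : Integrable A μ := by
    by_contra h
    rw [hm, integral_undef h] at hmean
    exact hmean.false
  set X : Ω → ℝ := fun ω => A ω / m with hX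
  have hX0 : ∀ ω, 0 ≤ X ω := fun ω => div_nonneg (hA0 ω) hmean.le
  have hXm : Measurable X := hA.div_const m
  have hXint : Integrable X μ := hAint.div_const m
  have hX2 : Integrable (fun ω => X ω ^ 2) μ := by
    simpa only [hX, div_pow] using hA2.div_const (m ^ 2)
  have hEX : ∫ ω, X ω ∂μ = 1 := by
    simp only [hX]
    rw [integral_div, ← hm, div_self hmean.ne']
  have hEX2 : ∫ ω, X ω ^ 2 ∂μ = (∫ ω, A ω ^ 2 ∂μ) / m ^ 2 := by
    simp only [hX, div_pow]
    rw [integral_div]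
  have hU2 : Integrable (fun ω => (X ω - 1) ^ 2) μ := by
    have := (hX2.sub (hXint.const_mul 2)).add (integrable_const (1 : ℝ))
    refine this.congr (Filter.Eventually.of_forall fun ω => ?_)
    simp only [Pi.add_apply, Pi.sub_apply]
    ring
  have hEU2 : ∫ ω, (X ω - 1) ^ 2 ∂μ = (∫ ω, A ω ^ 2 ∂μ) / m ^ 2 - 1 := by
    have e : ∀ ω, (X ω - 1) ^ 2 = X ω ^ 2 - 2 * X ω + 1 := fun ω => by ring
    simp only [e]
    rw [integral_add (by exact hX2.sub (hXint.const_mul 2)) (integrable_const _),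
      integral_sub hX2 (hXint.const_mul 2), integral_const_mul, hEX, hEX2]
    simp
    ring
  have hset : ∀ v : ℝ, {ω | (v + 1) * m < A ω} = {ω | v < X ω - 1} := by
    intro v
    ext ω
    simp only [Set.mem_ofPred_eq, hX, lt_sub_iff_add_lt, lt_div_iff₀ hmean]
  have hXlog : Integrable (fun ω => X ω * Real.log (X ω)) μ := by
    refine Integrable.mono' (hX2.add (integrable_const (1 : ℝ)))
      (hXm.mul hXm.log).aestronglyMeasurable (Filter.Eventually.of_forall fun ω => ?_)
    have h1 := Real.mul_log_sub_add_one_nonneg (hX0 ω)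
    have h2 := mul_le_mul_of_nonneg_left (Real.log_le_self (hX0 ω)) (hX0 ω)
    have h3 := hX0 ω
    simp only [Pi.add_apply, Real.norm_eq_abs, abs_le]
    constructor <;> nlinarith
  have htail := integral_indicator_sq_eq_integral_meas_lt μ (hXm.sub_const 1) hU2 hθ
  have hS : MeasurableSet {ω | θ < X ω - 1} := measurableSet_lt measurable_const (hXm.sub_const 1)
  have hmono : ∫ ω, c * ((X ω - 1) ^ 2
        - {ω | θ < X ω - 1}.indicator (fun ω => (X ω - 1) ^ 2) ω) ∂μ
      ≤ ∫ ω, (X ω * Real.log (X ω) - X ω + 1) ∂μ := by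
    refine integral_mono ((hU2.sub (hU2.indicator hS)).const_mul c)
      ((hXlog.sub hXint).add (integrable_const _)) fun ω => ?_
    by_cases h : θ < X ω - 1
    · simp only [Set.indicator_of_mem (show ω ∈ {ω | θ < X ω - 1} from h), sub_self, mul_zero]
      exact Real.mul_log_sub_add_one_nonneg (hX0 ω)
    · simp only [Set.indicator_of_notMem (show ω ∉ {ω | θ < X ω - 1} from h), sub_zero]
      exact Real.mul_sub_one_sq_le_mul_log_sub_add_one hθ (hX0 ω) (by linarith)
  rw [integral_const_mul, integral_sub hU2 (hU2.indicator hS), htail, hEU2,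
    integral_add (by exact hXlog.sub hXint) (integrable_const _), integral_sub hXlog hXint, hEX] at hmono
  have hR : ∫ ω, A ω * Real.log (A ω / m) ∂μ = m * ∫ ω, X ω * Real.log (X ω) ∂μ := by
    rw [← integral_const_mul]
    congr 1
    ext ω
    simp only [hX]
    field_simp
  rw [hR]
  simp only [hset]
  have := mul_le_mul_of_nonneg_left hmono hmean.le
  simp only [integral_const, probReal_univ, smul_eq_mul, mul_one, sub_add_cancel] at this
  refine le_trans (le_of_eq ?_) this
  field_simp
end

section
/- Define h₁ : (0,∞) → ℝ by h₁(t) := (t ln t − (t−1))/(t−1) for t ≠ 1 and h₁(1) := 0. Then h₁ is monotone increasing on (0,∞): for all 0 < s ≤ t, h₁(s) ≤ h₁(t). -/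
noncomputable section

/-- `h₁(t) = (t ln t − (t−1))/(t−1)` for `t ≠ 1`, continuously extended by `h₁(1) = 0`. -/
def h₁ (t : ℝ) : ℝ :=
  if t = 1 then 0 else (t * Real.log t - (t - 1)) / (t - 1)

theorem sub_one_le_mul_log {x : ℝ} (hx : 0 < x) : x - 1 ≤ x * Real.log x := by
  have h := mul_le_mul_of_nonneg_left (Real.one_sub_inv_le_log_of_pos hx) hx.le
  rwa [mul_sub, mul_one, mul_inv_cancel₀ hx.ne'] at h

theorem h₁_monotone : ∀ s t : ℝ, 0 < s → s ≤ t → h₁ s ≤ h₁ t := by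
  intro s t hs hst
  have ht : 0 < t := hs.trans_le hst
  unfold h₁
  split_ifs with hs1 ht1 ht1
  · exact le_rfl
  · exact div_nonneg (sub_nonneg.2 (sub_one_le_mul_log ht)) (by linarith)
  · exact div_nonpos_of_nonneg_of_nonpos (sub_nonneg.2 (sub_one_le_mul_log hs)) (by linarith)
  · have h := Real.convexOn_mul_log.secant_mono (a := 1) (by simp) hs.le ht.le hs1 ht1 hst
    simp only [Real.log_one, mul_zero, sub_zero] at h
    rw [sub_div _ (s - 1), sub_div _ (t - 1), div_self (sub_ne_zero.2 hs1), div_self (sub_ne_zero.2 ht1)]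
    linarith

end
end

section
/- Define h₂ : (0,∞) → ℝ by h₂(t) := (t ln t − (t−1))/(t−1)² for t ≠ 1 and h₂(1) := 1/2. Then h₂ is monotone decreasing on (0,∞): for all 0 < s ≤ t, h₂(s) ≥ h₂(t). -/
noncomputable section

/-- `h₂(t) = (t ln t − (t−1))/(t−1)²` for `t ≠ 1`, continuously extended by `h₂(1) = 1/2`. -/
def h₂ (t : ℝ) : ℝ :=
  if t = 1 then 1 / 2 else (t * Real.log t - (t - 1)) / (t - 1) ^ 2

lemma one_add_mul_sub_one_pos {t u : ℝ} (ht : 0 < t) (hu : u ∈ Set.Icc (0 : ℝ) 1) :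
    0 < 1 + u * (t - 1) := by
  obtain ⟨h0, h1⟩ := hu
  rcases h0.eq_or_lt with rfl | h0
  · norm_num
  · nlinarith [mul_pos h0 ht]

lemma intervalIntegrable_one_sub_div {t : ℝ} (ht : 0 < t) :
    IntervalIntegrable (fun u : ℝ => (1 - u) / (1 + u * (t - 1))) MeasureTheory.volume 0 1 := by
  apply ContinuousOn.intervalIntegrable_of_Icc zero_le_one
  exact ContinuousOn.div (by fun_prop) (by fun_prop)
    fun u hu => ne_of_gt (one_add_mul_sub_one_pos ht hu)

/-- The integral representation of `h₂`, which is the integral form of the remainder in the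
first-order Taylor expansion of `t ln t` at `1`. -/
lemma h₂_eq_integral {t : ℝ} (ht : 0 < t) :
    h₂ t = ∫ u in (0 : ℝ)..1, (1 - u) / (1 + u * (t - 1)) := by
  rcases eq_or_ne t 1 with rfl | h1
  · have h : ∫ u in (0 : ℝ)..1, (1 - u) = 1 / 2 := by
      rw [intervalIntegral.integral_sub (by simp) (by simp)]
      norm_num
    simp [h₂, h]
  have hc : t - 1 ≠ 0 := sub_ne_zero.2 h1
  rw [intervalIntegral.integral_eq_sub_of_hasDerivAt
    (f := fun u => t / (t - 1) ^ 2 * Real.log (1 + u * (t - 1)) - u / (t - 1)) _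
    (intervalIntegrable_one_sub_div ht)]
  · simp only [h₂, if_neg h1]
    norm_num
    field_simp
  · intro u hu
    rw [Set.uIcc_of_le zero_le_one] at hu
    have hpos := (one_add_mul_sub_one_pos ht hu).ne'
    have hlin : HasDerivAt (fun u : ℝ => 1 + u * (t - 1)) (t - 1) u := by
      simpa using ((hasDerivAt_id u).mul_const (t - 1)).const_add 1
    refine (((hlin.log hpos).const_mul (t / (t - 1) ^ 2)).sub
      ((hasDerivAt_id u).div_const (t - 1))).congr_deriv ?_
    generalize hw : 1 + u * (t - 1) = w at hpos
    field_simp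
    rw [← hw]
    ring

theorem h₂_antitone : ∀ s t : ℝ, 0 < s → s ≤ t → h₂ t ≤ h₂ s := by
  intro s t hs hst
  have ht := hs.trans_le hst
  rw [h₂_eq_integral hs, h₂_eq_integral ht]
  refine intervalIntegral.integral_mono_on zero_le_one (intervalIntegrable_one_sub_div ht)
    (intervalIntegrable_one_sub_div hs) fun u hu => ?_
  have hpos := one_add_mul_sub_one_pos hs hu
  obtain ⟨h0, h1⟩ := hu
  have hnum : 0 ≤ 1 - u := sub_nonneg.2 h1
  gcongr

end
end

section
/- Fix finite nonempty sets 𝒳, 𝒵 and a channel W from 𝒳 to 𝒵. For a joint pmf Q on 𝒳×𝒵 define g(Q,W) := Σ_{(x,z):Q(x,z)>0} Q(x,z) ln W(z|x) + H(Q_Z) + φ(Q), where φ(Q) := min{ D(Q'‖Q'_X×W) : Q' a joint pmf on 𝒳×𝒵 with Q'_X = Q_X and Q'_Z = Q_Z }. Then Q ↦ g(Q,W) is continuous on the set 𝒬 := { Q : Q ≪ Q_X×W } (with the topology induced by the ℓ1 distance on pmfs): for every sequence (Q_n) in 𝒬 converging to Q ∈ 𝒬, g(Q_n,W) → g(Q,W).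 -/
open Filter

noncomputable section

open scoped Classical in
/-- Extended-real KL divergence: `+∞` when `Q` is not absolutely continuous w.r.t. `Q'`. -/
def klDivE {α : Type*} [Fintype α] (Q Q' : α → ℝ) : EReal :=
  if AbsCont Q Q' then ((klDiv Q Q' : ℝ) : EReal) else ⊤

/-- `φ(Q) = min{ D(Q'‖Q'_X×W) : Q' a joint pmf with the same marginals as Q }`. -/
def phi {𝒳 𝒵 : Type*} [Fintype 𝒳] [Fintype 𝒵]
    (W : 𝒳 → 𝒵 → ℝ) (Q : 𝒳 × 𝒵 → ℝ) : EReal :=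
  sInf { d : EReal | ∃ Q' : 𝒳 × 𝒵 → ℝ, IsPMF Q' ∧
    margX Q' = margX Q ∧ margZ Q' = margZ Q ∧
    d = klDivE Q' (jointPW (margX Q') W) }

open scoped Classical in
/-- `g(Q,W) = Σ_{Q(x,z)>0} Q(x,z) ln W(z|x) + H(Q_Z) + φ(Q)` (the first sum being `−∞`
if some `W(z|x) = 0` with `Q(x,z) > 0`). -/
def gQW {𝒳 𝒵 : Type*} [Fintype 𝒳] [Fintype 𝒵]
    (Q : 𝒳 × 𝒵 → ℝ) (W : 𝒳 → 𝒵 → ℝ) : EReal :=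
  (if ∀ p : 𝒳 × 𝒵, 0 < Q p → 0 < W p.1 p.2 then
      ((∑ p : 𝒳 × 𝒵, if 0 < Q p then Q p * Real.log (W p.1 p.2) else 0 : ℝ) : EReal)
    else ⊥)
  + ((entropy (margZ Q) : ℝ) : EReal) + phi W Q

/-- `q` is a joint pmf with the same marginals as `Q` whose support lies in that of `W`. -/
def IsAdmissible {𝒳 𝒵 : Type*} [Fintype 𝒳] [Fintype 𝒵]
    (W : 𝒳 → 𝒵 → ℝ) (Q q : 𝒳 × 𝒵 → ℝ) : Prop :=
  IsPMF q ∧ margX q = margX Q ∧ margZ q = margZ Q ∧ ∀ p : 𝒳 × 𝒵, 0 < q p → 0 < W p.1 p.2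

/-- The everywhere defined, continuous expression for `D(q‖q_X×W)`. -/
def condDiv {𝒳 𝒵 : Type*} [Fintype 𝒳] [Fintype 𝒵]
    (W : 𝒳 → 𝒵 → ℝ) (q : 𝒳 × 𝒵 → ℝ) : ℝ :=
  ∑ p, (q p * Real.log (q p) - q p * Real.log (W p.1 p.2))
    - ∑ x, margX q x * Real.log (margX q x)

section

variable {𝒳 𝒵 : Type*}

lemma continuous_margX [Fintype 𝒵] :
    Continuous (margX : (𝒳 × 𝒵 → ℝ) → 𝒳 → ℝ) := by
  unfold margX; fun_prop

lemma continuous_margZ [Fintype 𝒳] :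
    Continuous (margZ : (𝒳 × 𝒵 → ℝ) → 𝒵 → ℝ) := by
  unfold margZ; fun_prop

lemma le_margX [Fintype 𝒵] {q : 𝒳 × 𝒵 → ℝ} (hq : ∀ p, 0 ≤ q p) (p : 𝒳 × 𝒵) :
    q p ≤ margX q p.1 :=
  Finset.single_le_sum (f := fun z => q (p.1, z)) (fun z _ => hq (p.1, z)) (Finset.mem_univ p.2)

lemma IsPMF.le_one {α : Type*} [Fintype α] {p : α → ℝ} (hp : IsPMF p) (a : α) : p a ≤ 1 :=
  hp.2 ▸ Finset.single_le_sum (fun b _ => hp.1 b) (Finset.mem_univ a)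

lemma sum_ite_pos_mul {α : Type*} [Fintype α] {q : α → ℝ} (hq : ∀ a, 0 ≤ q a) (f : α → ℝ) :
    (∑ a, if 0 < q a then q a * f a else 0) = ∑ a, q a * f a := by
  refine Finset.sum_congr rfl fun a _ => ?_
  split_ifs with h
  · rfl
  · rw [le_antisymm (not_lt.1 h) (hq a), zero_mul]

lemma absCont_jointPW_iff [Fintype 𝒵] {W : 𝒳 → 𝒵 → ℝ} {q : 𝒳 × 𝒵 → ℝ} (hq : ∀ p, 0 ≤ q p) :
    AbsCont q (jointPW (margX q) W) ↔ ∀ p : 𝒳 × 𝒵, 0 < q p → 0 < W p.1 p.2 := by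
  refine forall₂_congr fun p hp => ?_
  have hm : 0 < margX q p.1 := hp.trans_le (le_margX hq p)
  exact mul_pos_iff_of_pos_left hm

variable [Fintype 𝒳] [Fintype 𝒵] {W : 𝒳 → 𝒵 → ℝ}

lemma continuous_condDiv : Continuous (condDiv W) := by
  unfold condDiv
  refine (continuous_finsetSum _ fun p _ => ?_).sub (continuous_finsetSum _ fun x _ => ?_)
  · exact (Real.continuous_mul_log.comp (continuous_apply p)).sub
      ((continuous_apply p).mul continuous_const)
  · exact Real.continuous_mul_log.comp ((continuous_apply x).comp continuous_margX)

lemma klDiv_jointPW {q : 𝒳 × 𝒵 → ℝ} (hq : ∀ p, 0 ≤ q p)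
    (hS : ∀ p : 𝒳 × 𝒵, 0 < q p → 0 < W p.1 p.2) :
    klDiv q (jointPW (margX q) W) = condDiv W q := by
  have hX : ∑ x, margX q x * Real.log (margX q x)
      = ∑ p : 𝒳 × 𝒵, q p * Real.log (margX q p.1) := by
    rw [Fintype.sum_prod_type]
    exact Finset.sum_congr rfl fun x _ => Finset.sum_mul _ _ _
  rw [condDiv, hX, ← Finset.sum_sub_distrib, klDiv]
  refine Finset.sum_congr rfl fun p _ => ?_
  split_ifs with h
  · have hm : 0 < margX q p.1 := h.trans_le (le_margX hq p)
    rw [jointPW, Real.log_div h.ne' (mul_pos hm (hS p h)).ne', Real.log_mul hm.ne' (hS p h).ne']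
    ring
  · simp [le_antisymm (not_lt.1 h) (hq p)]

lemma phi_lt_iff {Q : 𝒳 × 𝒵 → ℝ} {c : EReal} :
    phi W Q < c ↔ ∃ q, IsAdmissible W Q q ∧ (condDiv W q : EReal) < c := by
  rw [phi, sInf_lt_iff]
  constructor
  · rintro ⟨_, ⟨q, hq, hX, hZ, rfl⟩, hlt⟩
    have hac : AbsCont q (jointPW (margX q) W) := by
      by_contra h
      rw [klDivE, if_neg h] at hlt
      exact not_top_lt hlt
    have hS := (absCont_jointPW_iff hq.1).1 hac
    rw [klDivE, if_pos hac, klDiv_jointPW hq.1 hS] at hlt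
    exact ⟨q, ⟨hq, hX, hZ, hS⟩, hlt⟩
  · rintro ⟨q, ⟨hq, hX, hZ, hS⟩, hlt⟩
    refine ⟨_, ⟨q, hq, hX, hZ, rfl⟩, ?_⟩
    rwa [klDivE, if_pos ((absCont_jointPW_iff hq.1).2 hS), klDiv_jointPW hq.1 hS]

lemma IsAdmissible.of_tendsto {Qn qn : ℕ → 𝒳 × 𝒵 → ℝ} {Q q : 𝒳 × 𝒵 → ℝ}
    (h : ∀ n, IsAdmissible W (Qn n) (qn n)) (hQ : Tendsto Qn atTop (nhds Q))
    (hq : Tendsto qn atTop (nhds q)) : IsAdmissible W Q q := by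
  have hp := tendsto_pi_nhds.1 hq
  refine ⟨⟨fun p => ge_of_tendsto' (hp p) fun n => (h n).1.1 p, ?_⟩, ?_, ?_, fun p hpos => ?_⟩
  · refine tendsto_nhds_unique (tendsto_finsetSum _ fun p _ => hp p) ?_
    simp only [(h _).1.2, tendsto_const_nhds]
  · refine tendsto_nhds_unique ((continuous_margX.tendsto q).comp hq) ?_
    simpa only [Function.comp_def, (h _).2.1] using (continuous_margX.tendsto Q).comp hQ
  · refine tendsto_nhds_unique ((continuous_margZ.tendsto q).comp hq) ?_
    simpa only [Function.comp_def, (h _).2.2.1] using (continuous_margZ.tendsto Q).comp hQ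
  · obtain ⟨n, hn⟩ := ((hp p).eventually (lt_mem_nhds hpos)).exists
    exact (h n).2.2.2 p hn

lemma eventually_lt_phi {Qn : ℕ → 𝒳 × 𝒵 → ℝ} {Q : 𝒳 × 𝒵 → ℝ}
    (hQ : Tendsto Qn atTop (nhds Q)) {c : EReal} (hc : c < phi W Q) :
    ∀ᶠ n in atTop, c < phi W (Qn n) := by
  by_contra hev
  obtain ⟨c', hcc', hc'⟩ := exists_between hc
  have hfr : ∃ᶠ n in atTop, phi W (Qn n) < c' :=
    (not_eventually.1 hev).mono fun n hn => (not_lt.1 hn).trans_lt hcc'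
  obtain ⟨σ, hσ, hlt⟩ := extraction_of_frequently_atTop hfr
  choose q hq hqlt using fun n => (phi_lt_iff).1 (hlt n)
  obtain ⟨r, -, τ, hτ, hr⟩ := (isCompact_Icc (a := (0 : 𝒳 × 𝒵 → ℝ)) (b := 1)).tendsto_subseq
    (x := q) fun n => ⟨(hq n).1.1, (hq n).1.le_one⟩
  have hadm : IsAdmissible W Q r := IsAdmissible.of_tendsto (fun n => hq (τ n))
    (hQ.comp (hσ.tendsto_atTop.comp hτ.tendsto_atTop)) hr
  have hle : (condDiv W r : EReal) ≤ c' :=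
    le_of_tendsto' (((continuous_coe_real_ereal.comp continuous_condDiv).tendsto r).comp hr)
      fun n => (hqlt (τ n)).le
  obtain ⟨d, hd, hd'⟩ := exists_between hc'
  exact lt_asymm hd' ((phi_lt_iff).2 ⟨r, hadm, hle.trans_lt hd⟩)

lemma eventually_phi_lt {Qn : ℕ → 𝒳 × 𝒵 → ℝ} {Q : 𝒳 × 𝒵 → ℝ}
    (hQn : ∀ n, IsPMF (Qn n)) (hS : ∀ n, ∀ p : 𝒳 × 𝒵, 0 < Qn n p → 0 < W p.1 p.2)
    (hQ0 : IsPMF Q) (hQ : Tendsto Qn atTop (nhds Q)) {c : EReal} (hc : phi W Q < c) :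
    ∀ᶠ n in atTop, phi W (Qn n) < c := by
  obtain ⟨q, ⟨hq, hqX, hqZ, hqS⟩, hqc⟩ := (phi_lt_iff).1 hc
  have hcont : Continuous fun r => (condDiv W r : EReal) :=
    continuous_coe_real_ereal.comp continuous_condDiv
  obtain ⟨t, ⟨ht0, ht1⟩, htc⟩ : ∃ t : ℝ, (0 < t ∧ t < 1) ∧
      (condDiv W (Q + t • (q - Q)) : EReal) < c := by
    have hlim : Tendsto (fun t : ℝ => (condDiv W (Q + t • (q - Q)) : EReal))
        (nhdsWithin 1 (Set.Iio 1)) (nhds (condDiv W q : EReal)) := by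
      have h : Continuous fun t : ℝ => (condDiv W (Q + t • (q - Q)) : EReal) :=
        hcont.comp (by fun_prop)
      simpa using (h.tendsto 1).mono_left nhdsWithin_le_nhds
    have hIoo : ∀ᶠ t : ℝ in nhdsWithin 1 (Set.Iio 1), 0 < t ∧ t < 1 :=
      Ioo_mem_nhdsLT one_pos
    exact (hIoo.and (hlim.eventually (gt_mem_nhds hqc))).exists
  have hlim : Tendsto (fun n => Qn n + t • (q - Q)) atTop (nhds (Q + t • (q - Q))) :=
    hQ.add_const _
  have hnonneg : ∀ᶠ n in atTop, ∀ p, 0 ≤ (Qn n + t • (q - Q)) p := by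
    refine eventually_all.2 fun p => ?_
    rcases (hQ0.1 p).eq_or_lt with h | h
    · refine Eventually.of_forall fun n => ?_
      have := mul_nonneg ht0.le (hq.1 p)
      have := (hQn n).1 p
      simp only [Pi.add_apply, Pi.smul_apply, Pi.sub_apply, smul_eq_mul, ← h, sub_zero]
      positivity
    · refine (((tendsto_pi_nhds.1 hlim) p).eventually (lt_mem_nhds (a := 0) ?_)).mono
        fun n hn => hn.le
      simp only [Pi.add_apply, Pi.smul_apply, Pi.sub_apply, smul_eq_mul]
      nlinarith [mul_nonneg ht0.le (hq.1 p), mul_pos (sub_pos.2 ht1) h]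
  filter_upwards [hnonneg, ((hcont.tendsto _).comp hlim).eventually (gt_mem_nhds htc)]
    with n hn hnc
  refine (phi_lt_iff).2 ⟨_, ⟨⟨hn, ?_⟩, ?_, ?_, fun p hp => ?_⟩, hnc⟩
  · simp [Finset.sum_add_distrib, ← Finset.mul_sum, (hQn n).2, hq.2, hQ0.2]
  · funext x
    have := congrFun hqX x
    simp only [margX] at this
    simp [margX, Finset.sum_add_distrib, ← Finset.mul_sum, this]
  · funext z
    have := congrFun hqZ z
    simp only [margZ] at this
    simp [margZ, Finset.sum_add_distrib, ← Finset.mul_sum, this]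
  · rcases ((hQn n).1 p).eq_or_lt with h | h
    · refine hqS p ((hq.1 p).lt_of_ne' fun h0 => ?_)
      simp only [Pi.add_apply, Pi.smul_apply, Pi.sub_apply, smul_eq_mul, ← h, h0] at hp
      nlinarith [mul_nonneg ht0.le (hQ0.1 p)]
    · exact hS n p h

lemma gQW_eq {Q : 𝒳 × 𝒵 → ℝ} (hQ : ∀ p, 0 ≤ Q p) (hS : ∀ p : 𝒳 × 𝒵, 0 < Q p → 0 < W p.1 p.2) :
    gQW Q W = ((∑ p : 𝒳 × 𝒵, Q p * Real.log (W p.1 p.2)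
      + -∑ z, margZ Q z * Real.log (margZ Q z) : ℝ) : EReal) + phi W Q := by
  have hZ : ∀ z, 0 ≤ margZ Q z := fun z => Finset.sum_nonneg fun x _ => hQ (x, z)
  rw [gQW, if_pos hS, sum_ite_pos_mul hQ fun p => Real.log (W p.1 p.2), entropy,
    sum_ite_pos_mul hZ fun z => Real.log (margZ Q z), EReal.coe_add]

end

theorem gQW_continuous_on_Q
    {𝒳 𝒵 : Type*} [Fintype 𝒳] [Fintype 𝒵] [Nonempty 𝒳] [Nonempty 𝒵]
    (W : 𝒳 → 𝒵 → ℝ) (hW : IsChannel W)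
    (Qn : ℕ → 𝒳 × 𝒵 → ℝ) (Q : 𝒳 × 𝒵 → ℝ)
    (hQn : ∀ n, IsPMF (Qn n) ∧ AbsCont (Qn n) (jointPW (margX (Qn n)) W))
    (hQ : IsPMF Q) (hac : AbsCont Q (jointPW (margX Q) W))
    (hconv : Filter.Tendsto (fun n => ∑ p, |Qn n p - Q p|) Filter.atTop (nhds 0)) :
    Filter.Tendsto (fun n => gQW (Qn n) W) Filter.atTop (nhds (gQW Q W)) := by
  have hlim : Tendsto Qn atTop (nhds Q) := by
    refine tendsto_pi_nhds.2 fun p => tendsto_iff_dist_tendsto_zero.2 ?_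
    refine squeeze_zero (fun _ => dist_nonneg) (fun n => ?_) hconv
    rw [Real.dist_eq]
    exact Finset.single_le_sum (f := fun p => |Qn n p - Q p|) (fun _ _ => abs_nonneg _)
      (Finset.mem_univ p)
  have hS := fun n => (absCont_jointPW_iff (hQn n).1.1).1 (hQn n).2
  have hSQ := (absCont_jointPW_iff hQ.1).1 hac
  have hphi : Tendsto (fun n => phi W (Qn n)) atTop (nhds (phi W Q)) :=
    tendsto_order.2 ⟨fun _ hc => eventually_lt_phi hlim hc,
      fun _ hc => eventually_phi_lt (fun n => (hQn n).1) hS hQ hlim hc⟩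
  have hreal : Continuous fun q : 𝒳 × 𝒵 → ℝ => ((∑ p : 𝒳 × 𝒵, q p * Real.log (W p.1 p.2)
      + -∑ z, margZ q z * Real.log (margZ q z) : ℝ) : EReal) := by
    refine continuous_coe_real_ereal.comp (Continuous.add (by fun_prop)
      (continuous_finsetSum _ fun z _ => ?_).neg)
    exact Real.continuous_mul_log.comp ((continuous_apply z).comp continuous_margZ)
  rw [gQW_eq hQ.1 hSQ]
  simp only [fun n => gQW_eq (hQn n).1.1 (hS n)]
  exact (EReal.continuousAt_add (Or.inl (EReal.coe_ne_top _))
    (Or.inl (EReal.coe_ne_bot _))).tendsto.comp (((hreal.tendsto Q).comp hlim).prodMk_nhds hphi)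

end
end

section
/- Fix finite nonempty sets 𝒳, 𝒵, a positive integer n, and an n-type Q on 𝒳×𝒵 with marginals Q_X (an n-type on 𝒳) and Q_Z (an n-type on 𝒵). Let T_Q^n := { (x^n,z^n) ∈ 𝒳^n×𝒵^n : the empirical joint type of (x^n,z^n) is Q }, T_{Q_X}^n := { x^n ∈ 𝒳^n : type(x^n)=Q_X }, T_{Q_Z}^n := { z^n ∈ 𝒵^n : type(z^n)=Q_Z }. Let P be a pmf on 𝒳^n such that P(x^n) depends only on the empirical type of x^n (equivalently, P is invariant under coordinate permutations). Then for every z^n ∈ 𝒵^n: Σ_{x^n : (x^n,z^n) ∈ T_Q^n} P(x^n) = ( |T_Q^n| / ( |T_{Q_X}^n| · |T_{Q_Z}^n| ) ) · P(T_{Q_X}^n) if type(z^n) = Q_Z, and the sum equals 0 otherwise. -/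
open Filter

noncomputable section

open scoped Classical in
/-- Empirical type of a sequence `x ∈ α^n`. -/
def typeOf {α : Type*} {n : ℕ} (x : Fin n → α) : α → ℝ :=
  fun a => ((Finset.univ.filter fun i => x i = a).card : ℝ) / n

theorem typeOf_comp_perm {α : Type*} {n : ℕ} (x : Fin n → α) (σ : Equiv.Perm (Fin n)) :
    typeOf (x ∘ σ) = typeOf x := by
  classical
  funext a
  unfold typeOf
  congr 2
  refine Finset.card_equiv σ fun i => ?_
  simp

/-- Two sequences of the same empirical type are permutations of each other. -/
theorem exists_perm_of_typeOf_eq {α : Type*} {n : ℕ} {w z : Fin n → α}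
    (h : typeOf w = typeOf z) : ∃ σ : Equiv.Perm (Fin n), z ∘ σ = w := by
  classical
  have hcard (a : α) : Fintype.card {i // w i = a} = Fintype.card {i // z i = a} := by
    rcases Nat.eq_zero_or_pos n with rfl | hn
    · simp
    have ha := congrFun h a
    unfold typeOf at ha
    rw [div_left_inj' (by positivity), Nat.cast_inj] at ha
    rw [Fintype.card_subtype, Fintype.card_subtype]
    convert ha
  let e (a : α) : {i // w i = a} ≃ {i // z i = a} := Fintype.equivOfCardEq (hcard a)
  refine ⟨(Equiv.sigmaFiberEquiv w).symm.trans
    ((Equiv.sigmaCongrRight e).trans (Equiv.sigmaFiberEquiv z)), ?_⟩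
  funext i
  exact (e (w i) ⟨i, rfl⟩).2

theorem margX_typeOf {α β : Type*} [Fintype β] {n : ℕ} (x : Fin n → α) (z : Fin n → β) :
    margX (typeOf fun i => (x i, z i)) = typeOf x := by
  classical
  funext a
  simp only [margX, typeOf, ← Finset.sum_div, ← Nat.cast_sum, Prod.mk.injEq]
  congr 2
  rw [Finset.card_eq_sum_card_fiberwise (f := z) (t := Finset.univ) (by simp)]
  simp only [Finset.filter_filter]

theorem margZ_typeOf {α β : Type*} [Fintype α] {n : ℕ} (x : Fin n → α) (z : Fin n → β) :
    margZ (typeOf fun i => (x i, z i)) = typeOf z := by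
  classical
  funext b
  simp only [margZ, typeOf, ← Finset.sum_div, ← Nat.cast_sum, Prod.mk.injEq]
  congr 2
  rw [Finset.card_eq_sum_card_fiberwise (f := x) (t := Finset.univ) (by simp)]
  simp only [Finset.filter_filter, and_comm]

/-- The number of sequences in joint type `Q` with a given sequence depends only on the type of
the latter. -/
theorem natCard_typeOf_pair_congr {α β : Type*} {n : ℕ} (Q : α × β → ℝ) {w z : Fin n → β}
    (h : typeOf w = typeOf z) :
    Nat.card {x : Fin n → α // typeOf (fun i => (x i, w i)) = Q} =
      Nat.card {x : Fin n → α // typeOf (fun i => (x i, z i)) = Q} := by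
  obtain ⟨σ, rfl⟩ := exists_perm_of_typeOf_eq h
  refine (Nat.card_congr ((Equiv.arrowCongr σ.symm (Equiv.refl α)).subtypeEquiv fun x => ?_)).symm
  rw [← typeOf_comp_perm (fun i => (x i, z i)) σ]
  rfl

/-- The joint type class has `|T_{Q_Z}|` fibres of equal size over its second coordinate. -/
theorem natCard_jointType {α β : Type*} [Fintype α] [Fintype β] {n : ℕ} (Q : α × β → ℝ)
    {z : Fin n → β} (hz : typeOf z = margZ Q) :
    Nat.card {p : (Fin n → α) × (Fin n → β) // typeOf (fun i => (p.1 i, p.2 i)) = Q} =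
      Nat.card {w : Fin n → β // typeOf w = margZ Q} *
        Nat.card {x : Fin n → α // typeOf (fun i => (x i, z i)) = Q} := by
  let e : {p : (Fin n → α) × (Fin n → β) // typeOf (fun i => (p.1 i, p.2 i)) = Q} ≃
      Σ w : {w : Fin n → β // typeOf w = margZ Q},
        {x : Fin n → α // typeOf (fun i => (x i, w.1 i)) = Q} :=
    { toFun := fun p =>
        ⟨⟨p.1.2, by rw [← margZ_typeOf p.1.1 p.1.2, p.2]⟩, ⟨p.1.1, p.2⟩⟩
      invFun := fun q => ⟨(q.2.1, q.1.1), q.2.2⟩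
      left_inv := fun _ => rfl
      right_inv := fun _ => rfl }
  classical
  rw [Nat.card_congr e, Nat.card_sigma,
    Finset.sum_congr rfl fun w _ => natCard_typeOf_pair_congr Q (w.2.trans hz.symm),
    Finset.sum_const, Finset.card_univ, ← Nat.card_eq_fintype_card, smul_eq_mul]

theorem sum_ite_eq_natCard_mul {α : Type*} [Fintype α] (p : α → Prop) [DecidablePred p]
    (f : α → ℝ) (c : ℝ) (h : ∀ a, p a → f a = c) :
    (∑ a, if p a then f a else 0) = (Nat.card {a // p a} : ℝ) * c := by
  rw [← Finset.sum_filter, Finset.sum_congr rfl fun a ha => h a (Finset.mem_filter.1 ha).2,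
    Finset.sum_const, nsmul_eq_mul, Nat.card_eq_fintype_card, Fintype.card_subtype]

open scoped Classical in
theorem multinomial_success_probability
    {𝒳 𝒵 : Type*} [Fintype 𝒳] [Fintype 𝒵] [Nonempty 𝒳] [Nonempty 𝒵]
    (n : ℕ) (hn : 0 < n)
    (Q : 𝒳 × 𝒵 → ℝ) (hQ : IsPMF Q) (hQtype : IsType n Q)
    (P : (Fin n → 𝒳) → ℝ) (hP : IsPMF P)
    (hPsym : ∀ x y : Fin n → 𝒳, typeOf x = typeOf y → P x = P y)
    (z : Fin n → 𝒵) :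
    (∑ x : Fin n → 𝒳, if typeOf (fun i => (x i, z i)) = Q then P x else 0)
      = if typeOf z = margZ Q then
          ((Nat.card {p : (Fin n → 𝒳) × (Fin n → 𝒵) //
              typeOf (fun i => ((p.1 i), (p.2 i))) = Q} : ℝ) /
            ((Nat.card {x : Fin n → 𝒳 // typeOf x = margX Q} : ℝ) *
              (Nat.card {w : Fin n → 𝒵 // typeOf w = margZ Q} : ℝ))) *
          (∑ x : Fin n → 𝒳, if typeOf x = margX Q then P x else 0)
        else 0 := by
  have hX {x : Fin n → 𝒳} (h : typeOf (fun i => (x i, z i)) = Q) :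
      typeOf x = margX Q := by rw [← margX_typeOf x z, h]
  split_ifs with hz
  · by_cases hne : ∃ x₀ : Fin n → 𝒳, typeOf x₀ = margX Q
    · obtain ⟨x₀, hx₀⟩ := hne
      have hc (x : Fin n → 𝒳) (hx : typeOf x = margX Q) : P x = P x₀ :=
        hPsym x x₀ (hx.trans hx₀.symm)
      rw [sum_ite_eq_natCard_mul _ P (P x₀) fun x hx => hc x (hX hx),
        sum_ite_eq_natCard_mul _ P (P x₀) hc, natCard_jointType Q hz]
      have : Nonempty {x : Fin n → 𝒳 // typeOf x = margX Q} := ⟨⟨x₀, hx₀⟩⟩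
      have : Nonempty {w : Fin n → 𝒵 // typeOf w = margZ Q} := ⟨⟨z, hz⟩⟩
      have hXpos : (Nat.card {x : Fin n → 𝒳 // typeOf x = margX Q} : ℝ) ≠ 0 :=
        Nat.cast_ne_zero.2 Nat.card_pos.ne'
      have hZpos : (Nat.card {w : Fin n → 𝒵 // typeOf w = margZ Q} : ℝ) ≠ 0 :=
        Nat.cast_ne_zero.2 Nat.card_pos.ne'
      push_cast
      field_simp
    · push Not at hne
      rw [Finset.sum_eq_zero fun x _ => if_neg fun h => hne x (hX h),
        Finset.sum_eq_zero fun x _ => if_neg (hne x), mul_zero]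
  · exact Finset.sum_eq_zero fun x _ => if_neg fun h => hz (by rw [← margZ_typeOf x z, h])

end
end
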